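/- arXiv:2508.06724 — 3 statements merged into one kernel-verified Lean document; each statement's English description precedes it below -/
import Mathlib

section
/- Let n ≥ 4 be a natural number and let N = ⌊(n+1)/2⌋. There exist N real numbers a_1, …, a_N with 1 < a_1 < a_2 < ⋯ < a_N such that: (1) if 1 < a < a_1, then the set {z ∈ ℂ, z ≠ 0 : f_a(z) = 0} has exactly 2n+1 elements; (2) if a_j < a < a_{j+1} for some 1 ≤ j < N, then this set has exactly 2n − 4j + 1 elements when n is even, and exactly 2n − 4j + 3 elements when n is odd; (3) if a > a_N, then this set has exactly 1 element. -/
/-- The family of complex-valued harmonic functions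
`f_a(z) = (a/(n+1))·z^(n+1) − (1/n)·z^(−n) + (1/(n+1))·(conj z)^(n+1) − (a/n)·(conj z)^(−n) − 1`. -/
noncomputable def fa (n : ℕ) (a : ℝ) (z : ℂ) : ℂ :=
  ((a : ℂ) / ((n : ℂ) + 1)) * z ^ (n + 1) - (1 / (n : ℂ)) * z ^ (-(n : ℤ)) +
    (1 / ((n : ℂ) + 1)) * (starRingEnd ℂ z) ^ (n + 1) -
    ((a : ℂ) / (n : ℂ)) * (starRingEnd ℂ z) ^ (-(n : ℤ)) - 1

open Set Real

/-- A strictly concave function takes each value at most twice. -/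
lemma StrictConcaveOn.eq_or_eq_of_eq {s : Set ℝ} {g : ℝ → ℝ} (hg : StrictConcaveOn ℝ s g)
    {u v w : ℝ} (hu : u ∈ s) (hv : v ∈ s) (hw : w ∈ s) (huv : u < v)
    (h₁ : g v = g u) (h₂ : g w = g u) : w = u ∨ w = v := by
  have key : ∀ x y z : ℝ, x ∈ s → z ∈ s → x < y → y < z → g y = g x → g z = g x → False := by
    intro x y z hx hz hxy hyz h1 h2
    have hmem : y ∈ openSegment ℝ x z := by
      rw [openSegment_eq_Ioo (hxy.trans hyz)]; exact ⟨hxy, hyz⟩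
    have := hg.lt_on_openSegment hx hz (hxy.trans hyz).ne hmem
    rw [h1, h2, min_self] at this
    exact lt_irrefl _ this
  by_contra! h
  rcases lt_or_gt_of_ne h.1 with h3 | h3
  · exact key w u v hw hv h3 huv h₂.symm (h₁.trans h₂.symm)
  · rcases lt_or_gt_of_ne h.2 with h4 | h4
    · exact key u w v hu hv h3 h4 h₂ h₁
    · exact key u v w hu hw huv h4 h₁ h₂

/-- A positive function with strictly concave logarithm that vanishes at both ends of an interval
takes every value strictly between zero and its maximum exactly twice. -/
lemma exists_max_and_pair {p q : ℝ} (hpq : p < q) {f : ℝ → ℝ} (hf : ContinuousOn f (Icc p q))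
    (hp : f p = 0) (hq : f q = 0) (hpos : ∀ x ∈ Ioo p q, 0 < f x)
    (hconc : StrictConcaveOn ℝ (Ioo p q) fun x => Real.log (f x)) :
    ∃ x₀ ∈ Ioo p q, (∀ x ∈ Ioo p q, f x ≤ f x₀) ∧
      ∀ L, 0 < L → L < f x₀ → ∃ u v, u ≠ v ∧ {x ∈ Ioo p q | f x = L} = {u, v} := by
  obtain ⟨x₀, hx₀, hmax⟩ := isCompact_Icc.exists_isMaxOn (nonempty_Icc.2 hpq.le) hf
  have hmid : (p + q) / 2 ∈ Ioo p q := ⟨by linarith, by linarith⟩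
  have h0 : 0 < f x₀ := (hpos _ hmid).trans_le (hmax (Ioo_subset_Icc_self hmid))
  have hx₀' : x₀ ∈ Ioo p q := by
    refine ⟨lt_of_le_of_ne hx₀.1 ?_, lt_of_le_of_ne hx₀.2 ?_⟩
    · rintro rfl; linarith
    · rintro rfl; linarith
  refine ⟨x₀, hx₀', fun x hx => hmax (Ioo_subset_Icc_self hx), fun L hL hLM => ?_⟩
  obtain ⟨u, hu, huL⟩ := intermediate_value_Ioo hx₀'.1.le
    (hf.mono (Icc_subset_Icc_right hx₀'.2.le)) (by rw [hp]; exact ⟨hL, hLM⟩)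
  obtain ⟨v, hv, hvL⟩ := intermediate_value_Ioo' hx₀'.2.le
    (hf.mono (Icc_subset_Icc_left hx₀'.1.le)) (by rw [hq]; exact ⟨hL, hLM⟩)
  have huv : u < v := hu.2.trans hv.1
  have hu' : u ∈ Ioo p q := ⟨hu.1, hu.2.trans hx₀'.2⟩
  have hv' : v ∈ Ioo p q := ⟨hx₀'.1.trans hv.1, hv.2⟩
  refine ⟨u, v, huv.ne, ?_⟩
  ext w
  constructor
  · rintro ⟨hw, hwL⟩
    exact hconc.eq_or_eq_of_eq hu' hv' hw huv (by simp only [huL, hvL]) (by simp only [huL, hwL])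
  · rintro (rfl | rfl)
    · exact ⟨hu', huL⟩
    · exact ⟨hv', hvL⟩

lemma abs_sin_nat_mul_le (n : ℕ) (x : ℝ) : |sin (n * x)| ≤ n * |sin x| := by
  induction n with
  | zero => simp
  | succ k ih =>
    rw [show ((k + 1 : ℕ) : ℝ) * x = k * x + x by push_cast; ring, sin_add]
    have h1 : |sin (k * x) * cos x| ≤ |sin (k * x)| := by
      rw [abs_mul]; exact mul_le_of_le_one_right (abs_nonneg _) (abs_cos_le_one _)
    have h2 : |cos (k * x) * sin x| ≤ |sin x| := by
      rw [abs_mul]; exact mul_le_of_le_one_left (abs_nonneg _) (abs_cos_le_one _)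
    have h3 := abs_add_le (sin (k * x) * cos x) (cos (k * x) * sin x)
    push_cast
    linarith

lemma abs_sin_nat_mul_lt {n : ℕ} (hn : 2 ≤ n) {x : ℝ} (hx : sin x ≠ 0) :
    |sin (n * x)| < n * |sin x| := by
  obtain ⟨k, rfl⟩ := Nat.exists_eq_add_of_le' hn
  have hs : 0 < |sin x| := abs_pos.2 hx
  have h0 := abs_sin_nat_mul_le k x
  rw [show ((k + 2 : ℕ) : ℝ) * x = k * x + 2 * x by push_cast; ring, sin_add, sin_two_mul]
  have hc : |cos x| < 1 := by
    rw [← sq_lt_one_iff_abs_lt_one]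
    nlinarith [sin_sq_add_cos_sq x, sq_pos_of_ne_zero hx]
  have h1 : |sin (k * x) * cos (2 * x)| ≤ |sin (k * x)| := by
    rw [abs_mul]; exact mul_le_of_le_one_right (abs_nonneg _) (abs_cos_le_one _)
  have h2 : |cos (k * x) * (2 * sin x * cos x)| < 2 * |sin x| := by
    rw [abs_mul, abs_mul, abs_mul, abs_two]
    have := mul_le_mul_of_nonneg_right (abs_cos_le_one (k * x))
      (by positivity : 0 ≤ 2 * |sin x| * |cos x|)
    nlinarith
  have h3 := abs_add_le (sin (k * x) * cos (2 * x)) (cos (k * x) * (2 * sin x * cos x))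
  push_cast
  linarith

/-- For `0 < p < x`, the ratio `sin (m * p) / sin (m * x)` increases with `m` as long as
`m * x < π`. -/
lemma sin_mul_sin_succ_lt {p x : ℝ} (hp : 0 < p) (hpx : p < x) {m : ℕ} (hm : 1 ≤ m)
    (hmx : m * x < π) :
    sin (m * p) * sin ((m + 1) * x) < sin ((m + 1) * p) * sin (m * x) := by
  have hx : 0 < x := hp.trans hpx
  induction m, hm using Nat.le_induction with
  | base =>
    norm_num at hmx ⊢
    rw [sin_two_mul, sin_two_mul]
    have h1 := sin_pos_of_pos_of_lt_pi hp (hpx.trans hmx)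
    have h2 := sin_pos_of_pos_of_lt_pi hx hmx
    have h3 := cos_lt_cos_of_nonneg_of_le_pi hp.le hmx.le hpx
    nlinarith [mul_pos h1 h2]
  | succ k hk ih =>
    push_cast at hmx ⊢
    have hk' : (1 : ℝ) ≤ k := by exact_mod_cast hk
    have ih' := ih (by nlinarith)
    have h1 : 0 < sin ((k + 1) * p) := sin_pos_of_pos_of_lt_pi (by positivity) (by nlinarith)
    have h2 : 0 < sin ((k + 1) * x) := sin_pos_of_pos_of_lt_pi (by positivity) hmx
    have h3 := cos_lt_cos_of_nonneg_of_le_pi hp.le (by nlinarith) hpx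
    have e : ∀ y : ℝ, sin ((k + 1 + 1) * y) + sin (k * y) = 2 * sin ((k + 1) * y) * cos y := by
      intro y
      rw [show ((k : ℝ) + 1 + 1) * y = (k + 1) * y + y by ring,
        show (k : ℝ) * y = (k + 1) * y - y by ring, sin_add, sin_sub]
      ring
    have e1 : sin ((k + 1 + 1) * p) = 2 * sin ((k + 1) * p) * cos p - sin (k * p) := by
      linarith [e p]
    have e2 : sin ((k + 1 + 1) * x) = 2 * sin ((k + 1) * x) * cos x - sin (k * x) := by
      linarith [e x]
    rw [e1, e2]
    nlinarith [mul_pos h1 h2]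

/-- In terms of `ψ = π - arg z = m * x`, the quantity that has to take a prescribed value for
there to be a zero of `fa` in the open upper half plane with that argument. -/
noncomputable def angleRatio (n m : ℕ) (x : ℝ) : ℝ :=
  sin (m * (π - n * x)) ^ n * sin (m * ((n + 1) * x - π)) ^ (n + 1) / sin (m * x) ^ (2 * n + 1)

section angleRatio

variable {n m : ℕ} {x : ℝ}

lemma angle_bounds (hm : 1 ≤ m) (hmn : m < n) (hx : x ∈ Ioo (π / (n + 1)) (π / n)) :
    0 < π - n * x ∧ 0 < (n + 1) * x - π ∧ m * x < π := by
  have hn0 : (0 : ℝ) < n := by exact_mod_cast (by omega : 0 < n)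
  have hmn' : (m : ℝ) ≤ n := by exact_mod_cast hmn.le
  have h1 := (div_lt_iff₀ (by positivity)).1 hx.1
  have h2 := (lt_div_iff₀ hn0).1 hx.2
  have hx0 : 0 < x := lt_trans (by positivity) hx.1
  exact ⟨by linarith, by linarith, by nlinarith⟩

lemma angle_sin_pos (hm : 1 ≤ m) (hmn : m < n) (hx : x ∈ Ioo (π / (n + 1)) (π / n)) :
    0 < sin (m * (π - n * x)) ∧ 0 < sin (m * ((n + 1) * x - π)) ∧ 0 < sin (m * x) := by
  obtain ⟨h1, h2, h3⟩ := angle_bounds hm hmn hx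
  have hm0 : (0 : ℝ) < m := by exact_mod_cast hm
  refine ⟨sin_pos_of_pos_of_lt_pi (by positivity) ?_,
    sin_pos_of_pos_of_lt_pi (by positivity) ?_, sin_pos_of_pos_of_lt_pi ?_ h3⟩
  · nlinarith
  · nlinarith
  · nlinarith

lemma angleRatio_pos (hm : 1 ≤ m) (hmn : m < n) (hx : x ∈ Ioo (π / (n + 1)) (π / n)) :
    0 < angleRatio n m x := by
  obtain ⟨h1, h2, h3⟩ := angle_sin_pos hm hmn hx
  unfold angleRatio
  positivity

lemma angleRatio_lt_succ (hm : 1 ≤ m) (hmn : m + 1 < n)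
    (hx : x ∈ Ioo (π / (n + 1)) (π / n)) : angleRatio n m x < angleRatio n (m + 1) x := by
  obtain ⟨b1, b2, b3⟩ := angle_bounds (by omega) hmn hx
  obtain ⟨s1, s2, s3⟩ := angle_sin_pos hm (by omega) hx
  obtain ⟨t1, t2, t3⟩ := angle_sin_pos (by omega) hmn hx
  obtain ⟨-, -, c3⟩ := angle_bounds hm (by omega) hx
  have h1 := sin_mul_sin_succ_lt b1 (by linarith : π - n * x < x) hm c3
  have h2 := sin_mul_sin_succ_lt b2 (by linarith : (n + 1) * x - π < x) hm c3
  have e : ∀ a b c : ℝ, a ^ n * b ^ (n + 1) / c ^ (2 * n + 1) = (a / c) ^ n * (b / c) ^ (n + 1) := by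
    intro a b c
    rw [div_pow, div_pow, div_mul_div_comm, ← pow_add]
    congr 2
    ring
  unfold angleRatio
  push_cast at t1 t2 t3 ⊢
  rw [e, e]
  apply mul_lt_mul'' _ _ (by positivity) (by positivity)
  · exact pow_lt_pow_left₀ ((div_lt_div_iff₀ s3 t3).2 h1) (by positivity) (by omega)
  · exact pow_lt_pow_left₀ ((div_lt_div_iff₀ s3 t3).2 h2) (by positivity) (by omega)

lemma hasDerivAt_log_sin (a b : ℝ) (h : sin (a * x + b) ≠ 0) :
    HasDerivAt (fun y => Real.log (sin (a * y + b))) (a * (cos (a * x + b) / sin (a * x + b))) x := by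
  have h1 : HasDerivAt (fun y => a * y + b) a x := by
    simpa using ((hasDerivAt_id x).const_mul a).add_const b
  exact (h1.sin.log h).congr_deriv (by ring)

lemma hasDerivAt_cos_div_sin (a b : ℝ) (h : sin (a * x + b) ≠ 0) :
    HasDerivAt (fun y => cos (a * y + b) / sin (a * y + b)) (-a / sin (a * x + b) ^ 2) x := by
  have h1 : HasDerivAt (fun y => a * y + b) a x := by
    simpa using ((hasDerivAt_id x).const_mul a).add_const b
  refine (h1.cos.div h1.sin h).congr_deriv ?_
  congr 1
  linear_combination (-a) * sin_sq_add_cos_sq (a * x + b)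

lemma strictConcaveOn_log_angleRatio (hm : 1 ≤ m) (hmn : m < n) :
    StrictConcaveOn ℝ (Ioo (π / (n + 1)) (π / n)) fun x => Real.log (angleRatio n m x) := by
  set I := Ioo (π / ((n : ℝ) + 1)) (π / n)
  let a₁ : ℝ := -(m * n)
  let b₁ : ℝ := m * π
  let a₂ : ℝ := m * (n + 1)
  let b₂ : ℝ := -(m * π)
  let a₃ : ℝ := m
  have e1 : ∀ x : ℝ, m * (π - n * x) = a₁ * x + b₁ := fun x => by simp only [a₁, b₁]; ring
  have e2 : ∀ x : ℝ, m * ((n + 1) * x - π) = a₂ * x + b₂ := fun x => by simp only [a₂, b₂]; ring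
  have e3 : ∀ x : ℝ, m * x = a₃ * x + 0 := fun x => by simp [a₃]
  have hs : ∀ x ∈ I, 0 < sin (a₁ * x + b₁) ∧ 0 < sin (a₂ * x + b₂) ∧ 0 < sin (a₃ * x + 0) := by
    intro x hx
    rw [← e1, ← e2, ← e3]
    exact angle_sin_pos hm hmn hx
  let g : ℝ → ℝ := fun x => n * Real.log (sin (a₁ * x + b₁)) +
    (n + 1) * Real.log (sin (a₂ * x + b₂)) - (2 * n + 1) * Real.log (sin (a₃ * x + 0))
  let g' : ℝ → ℝ := fun x => n * (a₁ * (cos (a₁ * x + b₁) / sin (a₁ * x + b₁))) +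
    (n + 1) * (a₂ * (cos (a₂ * x + b₂) / sin (a₂ * x + b₂))) -
    (2 * n + 1) * (a₃ * (cos (a₃ * x + 0) / sin (a₃ * x + 0)))
  have hg : ∀ x ∈ I, HasDerivAt g (g' x) x := fun x hx =>
    (((hasDerivAt_log_sin a₁ b₁ (hs x hx).1.ne').const_mul _).add
      ((hasDerivAt_log_sin a₂ b₂ (hs x hx).2.1.ne').const_mul _)).sub
      ((hasDerivAt_log_sin a₃ 0 (hs x hx).2.2.ne').const_mul _)
  have hg' : ∀ x ∈ I, HasDerivAt g' (n * (a₁ * (-a₁ / sin (a₁ * x + b₁) ^ 2)) +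
      (n + 1) * (a₂ * (-a₂ / sin (a₂ * x + b₂) ^ 2)) -
      (2 * n + 1) * (a₃ * (-a₃ / sin (a₃ * x + 0) ^ 2))) x := fun x hx =>
    ((((hasDerivAt_cos_div_sin a₁ b₁ (hs x hx).1.ne').const_mul _).const_mul _).add
      (((hasDerivAt_cos_div_sin a₂ b₂ (hs x hx).2.1.ne').const_mul _).const_mul _)).sub
      (((hasDerivAt_cos_div_sin a₃ 0 (hs x hx).2.2.ne').const_mul _).const_mul _)
  have hanti : StrictAntiOn g' I := by
    refine strictAntiOn_of_deriv_neg (convex_Ioo _ _)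
      (fun x hx => (hg' x hx).continuousAt.continuousWithinAt) fun x hx => ?_
    rw [interior_Ioo] at hx
    rw [(hg' x hx).deriv]
    obtain ⟨h1, h2, h3⟩ := hs x hx
    have hn0 : (0 : ℝ) < n := by exact_mod_cast (by omega : 0 < n)
    have hm0 : (0 : ℝ) < m := by exact_mod_cast hm
    have l1 : sin (a₁ * x + b₁) < n * sin (a₃ * x + 0) := by
      have := abs_sin_nat_mul_lt (by omega : 2 ≤ n) h3.ne'
      rw [abs_of_pos h3] at this
      refine lt_of_le_of_lt (le_abs_self _) (lt_of_eq_of_lt ?_ this)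
      rw [show a₁ * x + b₁ = m * π - n * (a₃ * x + 0) by simp only [a₁, b₁, a₃]; ring,
        sin_nat_mul_pi_sub]
      simp [abs_mul]
    have l2 : sin (a₂ * x + b₂) < (n + 1) * sin (a₃ * x + 0) := by
      have := abs_sin_nat_mul_lt (by omega : 2 ≤ n + 1) h3.ne'
      rw [abs_of_pos h3] at this
      push_cast at this
      refine lt_of_le_of_lt (le_abs_self _) (lt_of_eq_of_lt ?_ this)
      rw [show a₂ * x + b₂ = (n + 1) * (a₃ * x + 0) - m * π by simp only [a₂, b₂, a₃]; ring,
        sin_sub_nat_mul_pi]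
      simp [abs_mul]
    have k1 : 1 / sin (a₃ * x + 0) ^ 2 < n ^ 2 / sin (a₁ * x + b₁) ^ 2 := by
      rw [div_lt_div_iff₀ (by positivity) (by positivity), one_mul, ← mul_pow]
      exact pow_lt_pow_left₀ l1 h1.le two_ne_zero
    have k2 : 1 / sin (a₃ * x + 0) ^ 2 < (n + 1) ^ 2 / sin (a₂ * x + b₂) ^ 2 := by
      rw [div_lt_div_iff₀ (by positivity) (by positivity), one_mul, ← mul_pow]
      exact pow_lt_pow_left₀ l2 h2.le two_ne_zero
    have k3 : 0 < (m : ℝ) ^ 2 * (n * (n ^ 2 / sin (a₁ * x + b₁) ^ 2 - 1 / sin (a₃ * x + 0) ^ 2) +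
        (n + 1) * ((n + 1) ^ 2 / sin (a₂ * x + b₂) ^ 2 - 1 / sin (a₃ * x + 0) ^ 2)) := by
      have := sub_pos.2 k1
      have := sub_pos.2 k2
      positivity
    refine lt_of_eq_of_lt ?_ (neg_neg_of_pos k3)
    simp only [a₁, a₂, a₃]
    ring
  have hconc : StrictConcaveOn ℝ I g := by
    refine StrictAntiOn.strictConcaveOn_of_deriv (convex_Ioo _ _)
      (fun x hx => (hg x hx).continuousAt.continuousWithinAt) ?_
    rw [interior_Ioo]
    exact hanti.congr fun x hx => (hg x hx).deriv.symm
  refine hconc.congr fun x hx => ?_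
  obtain ⟨h1, h2, h3⟩ := hs x hx
  simp only [g, angleRatio, e1, e2, e3]
  rw [Real.log_div (by positivity) (by positivity), Real.log_mul (by positivity) (by positivity),
    Real.log_pow, Real.log_pow, Real.log_pow]
  push_cast
  ring

lemma exists_max_angleRatio (hm : 1 ≤ m) (hmn : m < n) :
    ∃ x₀ ∈ Ioo (π / (n + 1)) (π / n),
      (∀ x ∈ Ioo (π / (n + 1)) (π / n), angleRatio n m x ≤ angleRatio n m x₀) ∧
      ∀ L, 0 < L → L < angleRatio n m x₀ →
        ∃ u v, u ≠ v ∧ {x ∈ Ioo (π / (n + 1)) (π / n) | angleRatio n m x = L} = {u, v} := by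
  have hn0 : (0 : ℝ) < n := by exact_mod_cast (by omega : 0 < n)
  have hm0 : (0 : ℝ) < m := by exact_mod_cast hm
  have hmn' : (m : ℝ) < n := by exact_mod_cast hmn
  have hlt : π / ((n : ℝ) + 1) < π / n := div_lt_div_of_pos_left pi_pos hn0 (by linarith)
  refine exists_max_and_pair hlt ?_ ?_ ?_ (fun x hx => angleRatio_pos hm hmn hx)
    (strictConcaveOn_log_angleRatio hm hmn)
  · refine ContinuousOn.div (by fun_prop) (by fun_prop) fun x hx => ?_
    have hx0 : 0 < x := lt_of_lt_of_le (by positivity) hx.1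
    have hx1 := (le_div_iff₀ hn0).1 hx.2
    exact pow_ne_zero _ (sin_pos_of_pos_of_lt_pi (by positivity) (by nlinarith)).ne'
  · have : ((n : ℝ) + 1) * (π / (n + 1)) - π = 0 := by field_simp; ring
    simp [angleRatio, this]
  · have : π - n * (π / n) = 0 := by field_simp; ring
    simp only [angleRatio, this, mul_zero, sin_zero, zero_pow (by omega : n ≠ 0), zero_mul, zero_div]

end angleRatio

section critical

variable {n : ℕ}

lemma exists_critical_values (n : ℕ) : ∃ y : ℕ → ℝ,
    (∀ m, 1 ≤ m → m < n → 0 < y m) ∧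
    (∀ m, 1 ≤ m → m + 1 < n → y m < y (m + 1)) ∧
    (∀ m, 1 ≤ m → m < n → ∀ x ∈ Ioo (π / (n + 1)) (π / n),
      (n + 1) ^ n * n ^ (n + 1) * angleRatio n m x ≤ y m ^ (2 * n + 1)) ∧
    (∀ m, 1 ≤ m → m < n → ∀ b, 0 < b → b < y m → ∃ u v, u ≠ v ∧
      {x ∈ Ioo (π / (n + 1)) (π / n) |
        (n + 1) ^ n * n ^ (n + 1) * angleRatio n m x = b ^ (2 * n + 1)} = {u, v}) := by
  rcases Nat.eq_zero_or_pos n with rfl | hn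
  · exact ⟨0, by simp⟩
  have hC : (0 : ℝ) < (n + 1) ^ n * n ^ (n + 1) := by positivity
  set C : ℝ := (n + 1) ^ n * n ^ (n + 1)
  have h : ∀ m : ℕ, ∃ y x₀ : ℝ, 1 ≤ m → m < n → x₀ ∈ Ioo (π / (n + 1)) (π / n) ∧ 0 < y ∧
      y ^ (2 * n + 1) = C * angleRatio n m x₀ ∧
      (∀ x ∈ Ioo (π / (n + 1)) (π / n), angleRatio n m x ≤ angleRatio n m x₀) ∧
      ∀ L, 0 < L → L < angleRatio n m x₀ →
        ∃ u v, u ≠ v ∧ {x ∈ Ioo (π / (n + 1)) (π / n) | angleRatio n m x = L} = {u, v} := by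
    intro m
    by_cases hm : 1 ≤ m ∧ m < n
    · obtain ⟨x₀, hx₀, hmax, hpair⟩ := exists_max_angleRatio hm.1 hm.2
      have hp := mul_pos hC (angleRatio_pos hm.1 hm.2 hx₀)
      exact ⟨(C * angleRatio n m x₀) ^ (((2 * n + 1 : ℕ) : ℝ)⁻¹), x₀, fun _ _ =>
        ⟨hx₀, Real.rpow_pos_of_pos hp _, Real.rpow_inv_natCast_pow hp.le (by omega), hmax, hpair⟩⟩
    · exact ⟨0, 0, fun h1 h2 => absurd ⟨h1, h2⟩ hm⟩
  choose y x₀ hy using h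
  refine ⟨y, fun m h1 h2 => (hy m h1 h2).2.1, fun m h1 h2 => ?_, fun m h1 h2 x hx => ?_,
    fun m h1 h2 b hb hby => ?_⟩
  · obtain ⟨k1, k2, k3, k4, -⟩ := hy m h1 (by omega)
    obtain ⟨l1, l2, l3, l4, -⟩ := hy (m + 1) (by omega) h2
    refine lt_of_pow_lt_pow_left₀ (2 * n + 1) l2.le ?_
    rw [k3, l3]
    exact mul_lt_mul_of_pos_left ((angleRatio_lt_succ h1 h2 k1).trans_le (l4 _ k1)) hC
  · obtain ⟨k1, k2, k3, k4, -⟩ := hy m h1 h2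
    rw [k3]
    exact mul_le_mul_of_nonneg_left (k4 x hx) hC.le
  · obtain ⟨k1, k2, k3, k4, k5⟩ := hy m h1 h2
    obtain ⟨u, v, huv, he⟩ := k5 (b ^ (2 * n + 1) / C) (by positivity) (by
      rw [div_lt_iff₀' hC, ← k3]
      exact pow_lt_pow_left₀ hby hb.le (by omega))
    refine ⟨u, v, huv, ?_⟩
    rw [← he]
    ext x
    simp only [mem_ofPred_eq, eq_div_iff hC.ne', mul_comm C]

lemma angleRatio_midpoint {m : ℕ} (hm : 1 ≤ m) (hmn : m < n) :
    2 * π / (2 * n + 1) ∈ Ioo (π / ((n : ℝ) + 1)) (π / n) ∧ 0 < cos (m * π / (2 * n + 1)) ∧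
    angleRatio n m (2 * π / (2 * n + 1)) * (2 * cos (m * π / (2 * n + 1))) ^ (2 * n + 1) = 1 := by
  have hn0 : (0 : ℝ) < n := by exact_mod_cast (by omega : 0 < n)
  have hm0 : (0 : ℝ) < m := by exact_mod_cast hm
  have hmn' : (m : ℝ) < n := by exact_mod_cast hmn
  have hpi := pi_pos
  have hs : 0 < sin (m * π / (2 * n + 1)) := by
    refine sin_pos_of_pos_of_lt_pi (by positivity) ?_
    rw [div_lt_iff₀ (by positivity)]
    nlinarith
  have hc : 0 < cos (m * π / (2 * n + 1)) := by
    refine cos_pos_of_mem_Ioo ⟨lt_trans (neg_neg_of_pos (by positivity))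
      (by positivity : 0 < m * π / (2 * n + 1)), ?_⟩
    rw [div_lt_div_iff₀ (by positivity) (by positivity)]
    nlinarith
  refine ⟨⟨?_, ?_⟩, hc, ?_⟩
  · rw [div_lt_div_iff₀ (by positivity) (by positivity)]
    nlinarith
  · rw [div_lt_div_iff₀ (by positivity) (by positivity)]
    nlinarith
  · unfold angleRatio
    rw [show m * (π - n * (2 * π / (2 * n + 1))) = m * π / (2 * n + 1) by field_simp; ring,
      show m * ((n + 1) * (2 * π / (2 * n + 1)) - π) = m * π / (2 * n + 1) by field_simp; ring,
      show m * (2 * π / (2 * n + 1)) = 2 * (m * π / (2 * n + 1)) by ring, sin_two_mul,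
      ← pow_add, show n + (n + 1) = 2 * n + 1 by ring, ← div_pow, ← mul_pow]
    rw [show sin (m * π / (2 * n + 1)) / (2 * sin (m * π / (2 * n + 1)) *
      cos (m * π / (2 * n + 1))) * (2 * cos (m * π / (2 * n + 1))) = 1 by field_simp, one_pow]

lemma le_of_angleRatio_le {m : ℕ} (hm : 1 ≤ m) (hmn : m < n) {y : ℝ}
    (h : ∀ x ∈ Ioo (π / (n + 1)) (π / n),
      (n + 1) ^ n * n ^ (n + 1) * angleRatio n m x ≤ y ^ (2 * n + 1)) :
    ((n : ℝ) + 1) ^ n * n ^ (n + 1) ≤ (2 * cos (m * π / (2 * n + 1)) * y) ^ (2 * n + 1) := by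
  obtain ⟨h1, h2, h3⟩ := angleRatio_midpoint hm hmn
  have := mul_le_mul_of_nonneg_right (h _ h1)
    (by positivity : 0 ≤ (2 * cos (m * π / (2 * n + 1))) ^ (2 * n + 1))
  rwa [mul_assoc _ (angleRatio _ _ _), h3, mul_one, ← mul_pow, mul_comm y] at this

lemma two_lt_of_le (hn : 4 ≤ n) {y : ℝ} (hy : 0 < y)
    (h : ((n : ℝ) + 1) ^ n * n ^ (n + 1) ≤ (2 * cos ((1 : ℕ) * π / (2 * n + 1)) * y) ^ (2 * n + 1)) :
    2 < y := by
  have hn' : (4 : ℝ) ≤ n := by exact_mod_cast hn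
  by_contra! hy2
  have h1 : (2 * cos ((1 : ℕ) * π / (2 * n + 1)) * y) ^ (2 * n + 1) ≤ 4 ^ (2 * n + 1) := by
    refine (le_abs_self _).trans ?_
    rw [abs_pow]
    refine pow_le_pow_left₀ (abs_nonneg _) ?_ _
    rw [abs_mul, abs_mul, abs_two, abs_of_pos hy]
    have := abs_cos_le_one ((1 : ℕ) * π / (2 * n + 1))
    nlinarith [abs_nonneg (cos ((1 : ℕ) * π / (2 * n + 1)))]
  have h2 : (4 : ℝ) ^ (2 * n + 1) < ((n : ℝ) + 1) ^ n * n ^ (n + 1) := by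
    rw [show 2 * n + 1 = n + (n + 1) by ring, pow_add]
    refine mul_lt_mul (pow_lt_pow_left₀ (by linarith) (by norm_num) (by omega))
      (pow_le_pow_left₀ (by norm_num) hn' _) (by positivity) (by positivity)
  linarith

lemma lt_of_le_cos_two (hn : 4 ≤ n) {y : ℝ} (hy : 0 < y)
    (h : ((n : ℝ) + 1) ^ n * n ^ (n + 1) ≤ (2 * cos ((2 : ℕ) * π / (2 * n + 1)) * y) ^ (2 * n + 1))
    (hc : 0 < cos ((2 : ℕ) * π / (2 * n + 1))) :
    n * (n + 1) / (2 * n + 1) < y := by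
  have hn' : (4 : ℝ) ≤ n := by exact_mod_cast hn
  by_contra! hy2
  have hpi := pi_pos
  have hc1 : cos ((2 : ℕ) * π / (2 * n + 1)) ≤ 1 - 8 / (2 * n + 1) ^ 2 := by
    refine (cos_le_one_sub_mul_cos_sq (x := (2 : ℕ) * π / (2 * n + 1)) ?_).trans_eq ?_
    · rw [abs_of_pos (by positivity), div_le_iff₀ (by positivity)]
      push_cast
      nlinarith
    · push_cast
      field_simp
      ring
  set κ := cos ((2 : ℕ) * π / (2 * n + 1))
  have hκ : κ * (1 + 8 / (2 * n + 1) ^ 2) ≤ 1 := by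
    have : (0 : ℝ) < 8 / (2 * n + 1) ^ 2 := by positivity
    nlinarith
  have hκ2 : κ ^ (2 * n + 1) * (1 + 8 / (2 * n + 1)) ≤ 1 := by
    have h1 := one_add_mul_le_pow (a := 8 / (2 * (n : ℝ) + 1) ^ 2)
      (by have : (0 : ℝ) < 8 / (2 * n + 1) ^ 2 := by positivity
          linarith) (2 * n + 1)
    rw [show ((2 * n + 1 : ℕ) : ℝ) * (8 / (2 * (n : ℝ) + 1) ^ 2) = 8 / (2 * n + 1) by
      push_cast; field_simp] at h1
    calc _ ≤ κ ^ (2 * n + 1) * (1 + 8 / (2 * (n : ℝ) + 1) ^ 2) ^ (2 * n + 1) := by gcongr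
      _ ≤ 1 := by rw [← mul_pow]; exact pow_le_one₀ (by positivity) hκ
  have hκ3 : 2 * (n + 1) * κ ^ (2 * n + 1) < 2 * n + 1 := by
    have e : (1 : ℝ) + 8 / (2 * n + 1) = (2 * n + 9) / (2 * n + 1) := by field_simp; ring
    rw [e, mul_div_assoc', div_le_one (by positivity)] at hκ2
    have : 0 < κ ^ (2 * n + 1) := by positivity
    nlinarith
  have h4 : (4 * ((n : ℝ) * (n + 1))) ^ n ≤ ((2 * n + 1) ^ 2) ^ n :=
    pow_le_pow_left₀ (by positivity) (by nlinarith) _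
  have h5 : (4 * ((n : ℝ) * (n + 1))) ^ n * (2 * (n + 1) * κ ^ (2 * n + 1)) <
      ((2 * n + 1) ^ 2) ^ n * (2 * n + 1) :=
    mul_lt_mul' h4 hκ3 (by positivity) (by positivity)
  have h6 : (2 * κ * y) ^ (2 * n + 1) ≤ (2 * κ * (n * (n + 1) / (2 * n + 1))) ^ (2 * n + 1) :=
    pow_le_pow_left₀ (by positivity) (by gcongr) _
  have h7 : (2 * κ * (n * (n + 1) / (2 * n + 1))) ^ (2 * n + 1) * (2 * n + 1) ^ (2 * n + 1) =
      (4 * ((n : ℝ) * (n + 1))) ^ n * (2 * (n + 1) * κ ^ (2 * n + 1)) *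
        ((n + 1) ^ n * n ^ (n + 1)) := by
    rw [← mul_pow, show 2 * κ * (n * (n + 1) / (2 * n + 1)) * (2 * n + 1) =
      2 * κ * (n * ((n : ℝ) + 1)) by field_simp, show (4 : ℝ) = 2 * 2 by norm_num]
    simp only [mul_pow, pow_succ, pow_mul', pow_zero, one_mul]
    ring
  have h8 : ((2 * (n : ℝ) + 1) ^ 2) ^ n * (2 * n + 1) = (2 * n + 1) ^ (2 * n + 1) := by
    rw [← pow_mul, ← pow_succ]
  rw [h8] at h5
  have h9 := mul_lt_mul_of_pos_right h5 (by positivity : (0 : ℝ) < (n + 1) ^ n * n ^ (n + 1))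
  rw [← h7, mul_comm ((2 * (n : ℝ) + 1) ^ (2 * n + 1))] at h9
  have := lt_of_mul_lt_mul_right h9 (by positivity)
  linarith

end critical

section polar

/-- The function whose level `1 / (a + 1)` is the zero set of `fa n a`. -/
noncomputable def zeroMap (n : ℕ) (z : ℂ) : ℂ :=
  z ^ (n + 1) / (n + 1) - (starRingEnd ℂ z) ^ (-(n : ℤ)) / n

lemma fa_eq_zero_iff {n : ℕ} {a : ℝ} (ha : 1 < a) (z : ℂ) :
    fa n a z = 0 ↔ zeroMap n z = ((1 / (a + 1) : ℝ) : ℂ) := by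
  have h1 : fa n a z = a * zeroMap n z + starRingEnd ℂ (zeroMap n z) - 1 := by
    simp only [fa, zeroMap, map_sub, map_div₀, map_pow, map_zpow₀, map_add, map_natCast, map_one,
      RingHomCompTriple.comp_apply, RingHom.id_apply]
    ring
  rw [h1, Complex.ext_iff, Complex.ext_iff]
  simp only [Complex.sub_re, Complex.add_re, Complex.mul_re, Complex.ofReal_re, Complex.ofReal_im,
    Complex.conj_re, Complex.one_re, Complex.zero_re, Complex.sub_im, Complex.add_im, Complex.mul_im, Complex.conj_im, Complex.one_im, Complex.zero_im]
  have h2 : a + 1 ≠ 0 := by linarith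
  rw [eq_div_iff h2]
  constructor
  · rintro ⟨h3, h4⟩
    refine ⟨by linarith, ?_⟩
    have : (a - 1) * (zeroMap n z).im = 0 := by linarith
    exact (mul_eq_zero.1 this).resolve_left (by linarith)
  · rintro ⟨h3, h4⟩
    rw [h4]
    exact ⟨by linarith, by ring⟩

lemma zeroMap_conj (n : ℕ) (z : ℂ) :
    zeroMap n (starRingEnd ℂ z) = starRingEnd ℂ (zeroMap n z) := by
  simp [zeroMap]

lemma zeroMap_ofReal (n : ℕ) (x : ℝ) :
    zeroMap n x = ((x ^ (n + 1) / (n + 1) - (x ^ n)⁻¹ / n : ℝ) : ℂ) := by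
  simp [zeroMap]

lemma zeroMap_polar_eq_iff {n : ℕ} {r θ b : ℝ} (hθ : sin θ ≠ 0) (hb : 0 < b) :
    zeroMap n (r * (Complex.cos θ + Complex.sin θ * Complex.I)) = ((1 / b : ℝ) : ℂ) ↔
      r ^ (n + 1) / (n + 1) * (b * sin θ) = -sin (n * θ) ∧
      (r ^ n)⁻¹ / n * (b * sin θ) = -sin ((n + 1) * θ) := by
  set A : ℝ := r ^ (n + 1) / (n + 1) with hA
  set B : ℝ := (r ^ n)⁻¹ / n with hB
  have h1 : zeroMap n (r * (Complex.cos θ + Complex.sin θ * Complex.I)) =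
      A * (Complex.cos ((n + 1 : ℕ) * θ) + Complex.sin ((n + 1 : ℕ) * θ) * Complex.I) -
      B * (Complex.cos (n * θ) + Complex.sin (n * θ) * Complex.I) := by
    have h2 : starRingEnd ℂ (r * (Complex.cos θ + Complex.sin θ * Complex.I)) =
        r * (Complex.cos θ + Complex.sin θ * Complex.I)⁻¹ := by
      have : (Complex.cos θ + Complex.sin θ * Complex.I) *
          (Complex.cos θ - Complex.sin θ * Complex.I) = 1 := by
        linear_combination Complex.sin_sq_add_cos_sq θ - Complex.sin θ ^ 2 * Complex.I_sq
      rw [← eq_inv_of_mul_eq_one_right this]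
      simp [← Complex.cos_conj, ← Complex.sin_conj, sub_eq_add_neg]
    rw [zeroMap, h2, ← Complex.cos_add_sin_mul_I_pow, ← Complex.cos_add_sin_mul_I_pow, mul_pow, mul_zpow,
      inv_zpow', neg_neg, zpow_natCast, hA, hB]
    push_cast [zpow_neg, zpow_natCast]
    ring
  have hre : (zeroMap n (r * (Complex.cos θ + Complex.sin θ * Complex.I))).re =
      A * Real.cos ((n + 1) * θ) - B * Real.cos (n * θ) := by
    rw [h1]
    simp [Complex.add_re, ← Complex.ofReal_natCast, ← Complex.ofReal_mul, ← Complex.ofReal_one,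
      ← Complex.ofReal_add, -Complex.ofReal_cos, -Complex.ofReal_sin,
      ← Complex.ofReal_cos, ← Complex.ofReal_sin]
  have him : (zeroMap n (r * (Complex.cos θ + Complex.sin θ * Complex.I))).im =
      A * Real.sin ((n + 1) * θ) - B * Real.sin (n * θ) := by
    rw [h1]
    simp [Complex.add_re, ← Complex.ofReal_natCast, ← Complex.ofReal_mul, ← Complex.ofReal_one,
      ← Complex.ofReal_add, -Complex.ofReal_cos, -Complex.ofReal_sin,
      ← Complex.ofReal_cos, ← Complex.ofReal_sin]
  rw [Complex.ext_iff, hre, him, Complex.ofReal_re, Complex.ofReal_im, eq_div_iff hb.ne']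
  have hc : Real.cos ((n + 1) * θ) = Real.cos (n * θ) * Real.cos θ - sin (n * θ) * sin θ := by
    rw [add_mul, one_mul, Real.cos_add]
  have hs : sin ((n + 1) * θ) = sin (n * θ) * Real.cos θ + Real.cos (n * θ) * sin θ := by
    rw [add_mul, one_mul, Real.sin_add]
  have hw : sin ((n + 1) * θ) * Real.cos (n * θ) - Real.cos ((n + 1) * θ) * sin (n * θ) =
      sin θ := by
    rw [hc, hs]
    linear_combination sin θ * Real.sin_sq_add_cos_sq (n * θ)
  constructor
  · rintro ⟨h3, h4⟩
    constructor
    · linear_combination (-sin (n * θ)) * h3 + b * Real.cos (n * θ) * h4 - A * b * hw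
    · linear_combination (-sin ((n + 1) * θ)) * h3 + b * Real.cos ((n + 1) * θ) * h4 - B * b * hw
  · rintro ⟨h3, h4⟩
    constructor
    · apply mul_right_cancel₀ hθ
      linear_combination Real.cos ((n + 1) * θ) * h3 - Real.cos (n * θ) * h4 + hw
    · apply mul_right_cancel₀ (mul_ne_zero hb.ne' hθ)
      linear_combination sin ((n + 1) * θ) * h3 - sin (n * θ) * h4

end polar

section upper

variable {n m : ℕ} {x θ : ℝ}

lemma sin_mul_pi_sub (k : ℕ) (h : Odd (k + m)) (y : ℝ) :
    sin (k * (π - m * y)) = -sin (m * (π - k * y)) := by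
  rw [show (k : ℝ) * (π - m * y) = k * π - (m * π - m * (π - k * y)) by ring,
    sin_nat_mul_pi_sub, sin_nat_mul_pi_sub]
  have := h.neg_one_pow (α := ℝ)
  rw [pow_add] at this
  linear_combination sin (m * (π - k * y)) * this

lemma sin_succ_mul_pi_sub (h : Odd (n + m)) (y : ℝ) :
    sin ((n + 1) * (π - m * y)) = -sin (m * ((n + 1) * y - π)) := by
  rw [show ((n : ℝ) + 1) * (π - m * y) =
      (n + 1 : ℕ) * π - (m * ((n + 1) * y - π) + m * π) by push_cast; ring,
    sin_nat_mul_pi_sub, sin_add_nat_mul_pi]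
  have := h.neg_one_pow (α := ℝ)
  rw [pow_add] at this
  rw [pow_succ]
  linear_combination sin (m * ((n + 1) * y - π)) * this

/-- The set of arguments where both sines in the polar form of the equation are negative. -/
lemma exists_angle_param (h0 : 0 < θ) (hπ : θ < π) (h1 : sin (n * θ) < 0)
    (h2 : sin ((n + 1) * θ) < 0) :
    ∃ m : ℕ, 1 ≤ m ∧ m < n ∧ Odd (n + m) ∧ ∃ x ∈ Ioo (π / (n + 1)) (π / n), θ = π - m * x := by
  have hpi := pi_pos
  set ψ := π - θ with hψ
  have hθ : θ = π - ψ := by rw [hψ]; ring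
  have hψ0 : 0 < ψ := by linarith
  have hψπ : ψ < π := by linarith
  have hn0 : n ≠ 0 := by rintro rfl; simp at h1
  have hn0' : (0 : ℝ) < n := by positivity
  set m := ⌊(n + 1) * ψ / π⌋₊ with hm
  have hm1 : m * π ≤ (n + 1) * ψ :=
    (le_div_iff₀ hpi).1 (Nat.floor_le (by positivity : 0 ≤ (n + 1) * ψ / π))
  have hm2 : (n + 1) * ψ < (m + 1) * π := (div_lt_iff₀ hpi).1 (Nat.lt_floor_add_one _)
  set t := (n + 1) * ψ - m * π with ht
  have e2 : sin ((n + 1) * θ) = (-1) ^ (n + m) * sin t := by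
    rw [hθ, show ((n : ℝ) + 1) * (π - ψ) = (n + 1 : ℕ) * π - (t + m * π) by
      rw [ht]; push_cast; ring, sin_nat_mul_pi_sub, sin_add_nat_mul_pi, pow_succ, pow_add]
    ring
  have e1 : sin (n * θ) = (-1) ^ (n + m) * sin (ψ - t) := by
    rw [hθ, show (n : ℝ) * (π - ψ) = n * π - (m * π - (ψ - t)) by rw [ht]; ring,
      sin_nat_mul_pi_sub, sin_nat_mul_pi_sub, pow_add]
    ring
  have hodd : Odd (n + m) := by
    by_contra h
    rw [(Nat.not_odd_iff_even.1 h).neg_one_pow, one_mul] at e2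
    exact absurd (sin_nonneg_of_nonneg_of_le_pi (by linarith : 0 ≤ t) (by linarith)) (by linarith)
  rw [hodd.neg_one_pow] at e1 e2
  have ht0 : 0 < t := by
    refine lt_of_le_of_ne (by linarith) fun h => ?_
    rw [← h, sin_zero] at e2
    linarith
  have hs0 : 0 < ψ - t := by
    by_contra! h
    linarith [sin_nonpos_of_nonpos_of_neg_pi_le h (by linarith)]
  have hm0 : m ≠ 0 := by
    intro h
    rw [ht, h] at hs0
    push_cast at hs0
    nlinarith
  have hm0' : (0 : ℝ) < m := by positivity
  have hmn : m < n + 1 := by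
    have : (m : ℝ) < n + 1 := by
      by_contra! h
      nlinarith
    exact_mod_cast this
  have hmn' : m ≠ n := by
    intro h
    rw [h] at hodd
    exact Nat.not_odd_iff_even.2 ⟨n, rfl⟩ hodd
  refine ⟨m, by omega, by omega, hodd, ψ / m, ⟨?_, ?_⟩, ?_⟩
  · rw [div_lt_div_iff₀ (by positivity) hm0']
    linarith
  · rw [div_lt_div_iff₀ hm0' hn0']
    linarith
  · rw [mul_div_cancel₀ _ hm0'.ne', hθ]

lemma angle_param_unique {m' : ℕ} {x' : ℝ} (hm : 1 ≤ m) (hmn : m < n)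
    (hm' : 1 ≤ m') (hmn' : m' < n) (hx : x ∈ Ioo (π / (n + 1)) (π / n))
    (hx' : x' ∈ Ioo (π / (n + 1)) (π / n)) (h : m * x = m' * x') : m = m' := by
  have key : ∀ {k k' : ℕ} {y y' : ℝ}, 1 ≤ k → k < n → 1 ≤ k' → k' < n →
      y ∈ Ioo (π / (n + 1)) (π / n) → y' ∈ Ioo (π / (n + 1)) (π / n) →
      k * y = k' * y' → ¬ k < k' := by
    intro k k' y y' h1 h2 h3 h4 hy hy' he hlt
    obtain ⟨a1, a2, a3⟩ := angle_bounds h1 h2 hy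
    obtain ⟨b1, b2, b3⟩ := angle_bounds h3 h4 hy'
    have hlt' : (k : ℝ) + 1 ≤ k' := by exact_mod_cast hlt
    have hk0 : (0 : ℝ) < k := by exact_mod_cast h1
    have hk0' : (0 : ℝ) < k' := by exact_mod_cast h3
    have c1 := mul_pos hk0' b2
    have c2 := mul_pos hk0 a1
    have c3 : ((n : ℝ) + 1) * (k * y) = (n + 1) * (k' * y') := by rw [he]
    nlinarith [pi_pos]
  rcases lt_trichotomy m m' with h1 | h1 | h1
  · exact absurd h1 (key hm hmn hm' hmn' hx hx' h)
  · exact h1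
  · exact absurd h1 (key hm' hmn' hm hmn hx' hx h.symm)

lemma exists_radius_iff {b : ℝ} (hb : 0 < b) (hm : 1 ≤ m) (hmn : m < n) (hodd : Odd (n + m))
    (hx : x ∈ Ioo (π / (n + 1)) (π / n)) :
    (∃ r : ℝ, 0 < r ∧
      zeroMap n (r * (Complex.cos ↑(π - m * x) + Complex.sin ↑(π - m * x) * Complex.I)) =
        ((1 / b : ℝ) : ℂ)) ↔
    (n + 1) ^ n * n ^ (n + 1) * angleRatio n m x = b ^ (2 * n + 1) := by
  obtain ⟨s1, s2, s3⟩ := angle_sin_pos hm hmn hx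
  have hn0 : (0 : ℝ) < n := by exact_mod_cast (by omega : 0 < n)
  have e3 : sin (π - m * x) = sin (m * x) := sin_pi_sub _
  have key : ∀ r : ℝ, zeroMap n (r * (Complex.cos ↑(π - m * x) +
      Complex.sin ↑(π - m * x) * Complex.I)) = ((1 / b : ℝ) : ℂ) ↔
      r ^ (n + 1) / (n + 1) * (b * sin (m * x)) = sin (m * (π - n * x)) ∧
      (r ^ n)⁻¹ / n * (b * sin (m * x)) = sin (m * ((n + 1) * x - π)) := by
    intro r
    rw [zeroMap_polar_eq_iff (by rw [e3]; exact s3.ne') hb, sin_mul_pi_sub n hodd,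
      sin_succ_mul_pi_sub hodd, neg_neg, neg_neg, e3]
  have hAB : ∀ r : ℝ, 0 < r → ((n : ℝ) + 1) ^ n * n ^ (n + 1) *
      ((r ^ (n + 1) / (n + 1)) ^ n * ((r ^ n)⁻¹ / n) ^ (n + 1)) = 1 := by
    intro r hr
    have hr1 : (r ^ (n + 1)) ^ n * ((r ^ n)⁻¹) ^ (n + 1) = 1 := by
      rw [inv_pow, ← pow_mul, ← pow_mul, mul_comm n]
      exact mul_inv_cancel₀ (by positivity)
    rw [div_pow, div_pow, div_mul_div_comm, hr1]
    exact mul_one_div_cancel (by positivity)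
  have hH : (n + 1) ^ n * n ^ (n + 1) * angleRatio n m x = b ^ (2 * n + 1) ↔
      ((n : ℝ) + 1) ^ n * n ^ (n + 1) * (sin (m * (π - n * x)) ^ n *
        sin (m * ((n + 1) * x - π)) ^ (n + 1)) = (b * sin (m * x)) ^ (2 * n + 1) := by
    rw [angleRatio, mul_div_assoc', div_eq_iff (by positivity), mul_pow]
  have hsplit : ∀ y : ℝ, y ^ (2 * n + 1) = y ^ n * y ^ (n + 1) := by
    intro y
    rw [← pow_add]
    congr 1
    ring
  rw [hH]
  constructor
  · rintro ⟨r, hr, h⟩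
    obtain ⟨h1, h2⟩ := (key r).1 h
    rw [← h1, ← h2, mul_pow, mul_pow, hsplit]
    linear_combination ((b * sin (m * x)) ^ n * (b * sin (m * x)) ^ (n + 1)) * hAB r hr
  · intro h
    have hpos : 0 < (n + 1) * sin (m * (π - n * x)) / (b * sin (m * x)) := by positivity
    set r := ((n + 1) * sin (m * (π - n * x)) / (b * sin (m * x))) ^ (((n + 1 : ℕ) : ℝ)⁻¹) with hr
    have hr0 : 0 < r := Real.rpow_pos_of_pos hpos _
    have hrn : r ^ (n + 1) = (n + 1) * sin (m * (π - n * x)) / (b * sin (m * x)) :=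
      Real.rpow_inv_natCast_pow hpos.le (by omega)
    have h1 : r ^ (n + 1) / (n + 1) * (b * sin (m * x)) = sin (m * (π - n * x)) := by
      rw [hrn]
      field_simp
    refine ⟨r, hr0, (key r).2 ⟨h1, ?_⟩⟩
    refine (pow_left_inj₀ (by positivity) s2.le (by omega : n + 1 ≠ 0)).1 ?_
    rw [← h1, hsplit, mul_pow] at h
    have h3 := hAB r hr0
    have hC : 0 < ((n : ℝ) + 1) ^ n * n ^ (n + 1) * (r ^ (n + 1) / (n + 1)) ^ n := by positivity
    have hb' : 0 < (b * sin (m * x)) ^ n := by positivity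
    apply mul_left_cancel₀ (mul_pos hC hb').ne'
    rw [mul_pow]
    linear_combination (b * sin (m * x)) ^ n * (b * sin (m * x)) ^ (n + 1) * h3 - h

lemma arg_injOn_upper {b : ℝ} (hb : 0 < b) :
    InjOn Complex.arg {z : ℂ | 0 < z.im ∧ zeroMap n z = ((1 / b : ℝ) : ℂ)} := by
  rintro z ⟨hz, hz'⟩ w ⟨hw, hw'⟩ h
  have hz0 : z ≠ 0 := by rintro rfl; simp at hz
  have hw0 : w ≠ 0 := by rintro rfl; simp at hw
  have hs : 0 < sin z.arg := by
    rw [Complex.sin_arg]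
    exact div_pos hz (norm_pos_iff.2 hz0)
  rw [← Complex.norm_mul_cos_add_sin_mul_I z, zeroMap_polar_eq_iff hs.ne' hb] at hz'
  rw [← Complex.norm_mul_cos_add_sin_mul_I w, ← h, zeroMap_polar_eq_iff hs.ne' hb] at hw'
  have h1 := hz'.1.trans hw'.1.symm
  have h2 : ‖z‖ ^ (n + 1) = ‖w‖ ^ (n + 1) := by
    have := mul_right_cancel₀ (mul_pos hb hs).ne' h1
    rwa [div_left_inj' (by positivity)] at this
  have h3 := (pow_left_inj₀ (norm_nonneg z) (norm_nonneg w) (by omega : n + 1 ≠ 0)).1 h2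
  exact Complex.ext_norm_arg h3 h

lemma arg_image_upper {b : ℝ} (hb : 0 < b) :
    Complex.arg '' {z : ℂ | 0 < z.im ∧ zeroMap n z = ((1 / b : ℝ) : ℂ)} =
      {θ | ∃ m : ℕ, 1 ≤ m ∧ m < n ∧ Odd (n + m) ∧ ∃ x ∈ Ioo (π / (n + 1)) (π / n),
        θ = π - m * x ∧ (n + 1) ^ n * n ^ (n + 1) * angleRatio n m x = b ^ (2 * n + 1)} := by
  ext θ
  constructor
  · rintro ⟨z, ⟨hz, hz'⟩, rfl⟩
    have hz0 : z ≠ 0 := by rintro rfl; simp at hz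
    have hs : 0 < sin z.arg := by
      rw [Complex.sin_arg]
      exact div_pos hz (norm_pos_iff.2 hz0)
    have hr : 0 < ‖z‖ := norm_pos_iff.2 hz0
    have h0 : 0 < z.arg := by
      by_contra! h
      linarith [sin_nonpos_of_nonpos_of_neg_pi_le h (Complex.neg_pi_lt_arg z).le]
    have hπ : z.arg < π := lt_of_le_of_ne (Complex.arg_le_pi z) fun h => by
      rw [h, sin_pi] at hs
      exact lt_irrefl _ hs
    rw [← Complex.norm_mul_cos_add_sin_mul_I z] at hz'
    have hz2 := (zeroMap_polar_eq_iff hs.ne' hb).1 hz'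
    rcases Nat.eq_zero_or_pos n with rfl | hn
    · simp [hs.ne', hb.ne', hr.ne'] at hz2
    obtain ⟨m, hm, hmn, hodd, x, hx, he⟩ := exists_angle_param (n := n) h0 hπ
      (by
        have : 0 < ‖z‖ ^ (n + 1) / (n + 1) * (b * sin z.arg) := by positivity
        linarith [hz2.1])
      (by
        have : 0 < (‖z‖ ^ n)⁻¹ / n * (b * sin z.arg) := by positivity
        linarith [hz2.2])
    refine ⟨m, hm, hmn, hodd, x, hx, he, ?_⟩
    rw [he] at hz'
    exact (exists_radius_iff hb hm hmn hodd hx).1 ⟨_, hr, hz'⟩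
  · rintro ⟨m, hm, hmn, hodd, x, hx, rfl, h⟩
    obtain ⟨r, hr, hz⟩ := (exists_radius_iff hb hm hmn hodd hx).2 h
    obtain ⟨-, -, s3⟩ := angle_sin_pos hm hmn hx
    have hm0 : (0 : ℝ) < m := by exact_mod_cast hm
    have hx0 : 0 < x := lt_trans (by positivity) hx.1
    have hmx : 0 < m * x := by positivity
    have hmx' := (angle_bounds hm hmn hx).2.2
    have harg : Complex.arg (r * (Complex.cos ↑(π - m * x) +
        Complex.sin ↑(π - m * x) * Complex.I)) = π - m * x :=
      Complex.arg_mul_cos_add_sin_mul_I hr ⟨by linarith [pi_pos], by linarith⟩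
    refine ⟨_, ⟨?_, hz⟩, harg⟩
    rw [← Complex.ofReal_cos, ← Complex.ofReal_sin, sin_pi_sub]
    simp only [Complex.im_ofReal_mul, Complex.add_im, Complex.ofReal_im, Complex.I_im, mul_one,
      zero_add]
    exact mul_pos hr s3

/-- The number of zeros in the upper half plane is twice the number of admissible indices `m` for
which the level is attained. -/
lemma encard_upper {b : ℝ} (hb : 0 < b) (T : Finset ℕ)
    (hT : ∀ m ∈ T, 1 ≤ m ∧ m < n ∧ Odd (n + m) ∧ ∃ u v, u ≠ v ∧
      {x ∈ Ioo (π / (n + 1)) (π / n) |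
        (n + 1) ^ n * n ^ (n + 1) * angleRatio n m x = b ^ (2 * n + 1)} = {u, v})
    (hT' : ∀ m, 1 ≤ m → m < n → Odd (n + m) → m ∉ T → ∀ x ∈ Ioo (π / (n + 1)) (π / n),
      (n + 1) ^ n * n ^ (n + 1) * angleRatio n m x ≠ b ^ (2 * n + 1)) :
    {z : ℂ | 0 < z.im ∧ zeroMap n z = ((1 / b : ℝ) : ℂ)}.encard = (2 * T.card : ℕ) := by
  rw [← (arg_injOn_upper hb).encard_image, arg_image_upper hb]
  have h : ∀ m : ℕ, ∃ u v : ℝ, m ∈ T → u ≠ v ∧ {x ∈ Ioo (π / (n + 1)) (π / n) |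
        (n + 1) ^ n * n ^ (n + 1) * angleRatio n m x = b ^ (2 * n + 1)} = {u, v} := by
    intro m
    by_cases hm : m ∈ T
    · obtain ⟨-, -, -, u, v, h⟩ := hT m hm
      exact ⟨u, v, fun _ => h⟩
    · exact ⟨0, 0, fun h => absurd h hm⟩
  choose u v huv using h
  have hu : ∀ m ∈ T, ∀ x, x = u m ∨ x = v m ↔ x ∈ Ioo (π / (n + 1)) (π / n) ∧
      (n + 1) ^ n * n ^ (n + 1) * angleRatio n m x = b ^ (2 * n + 1) := fun m hm x =>
    (Set.ext_iff.1 (huv m hm).2 x).symm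
  have hset : {θ | ∃ m : ℕ, 1 ≤ m ∧ m < n ∧ Odd (n + m) ∧ ∃ x ∈ Ioo (π / (n + 1)) (π / n),
        θ = π - m * x ∧ (n + 1) ^ n * n ^ (n + 1) * angleRatio n m x = b ^ (2 * n + 1)} =
      ↑(T.biUnion fun m => {π - m * u m, π - m * v m}) := by
    ext θ
    simp only [mem_ofPred_eq, Finset.coe_biUnion, mem_iUnion, Finset.coe_pair, mem_insert_iff,
      mem_singleton_iff, Finset.mem_coe]
    constructor
    · rintro ⟨m, hm, hmn, hodd, x, hx, rfl, h⟩
      have hmT : m ∈ T := by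
        by_contra hmT
        exact hT' m hm hmn hodd hmT x hx h
      refine ⟨m, hmT, ?_⟩
      rcases (hu m hmT x).2 ⟨hx, h⟩ with rfl | rfl
      · exact Or.inl rfl
      · exact Or.inr rfl
    · rintro ⟨m, hmT, h⟩
      obtain ⟨hm, hmn, hodd, -⟩ := hT m hmT
      refine ⟨m, hm, hmn, hodd, ?_⟩
      rcases h with rfl | rfl
      · have := (hu m hmT (u m)).1 (Or.inl rfl)
        exact ⟨u m, this.1, rfl, this.2⟩
      · have := (hu m hmT (v m)).1 (Or.inr rfl)
        exact ⟨v m, this.1, rfl, this.2⟩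
  rw [hset, encard_coe_eq_coe_finsetCard, Finset.card_biUnion]
  · rw [Finset.sum_congr rfl fun m hm => Finset.card_pair (a := π - m * u m) (b := π - m * v m) ?_]
    · simp [mul_comm]
    · intro h
      have hm0 : (m : ℝ) ≠ 0 := by
        have := (hT m hm).1
        positivity
      exact (huv m hm).1 (mul_left_cancel₀ hm0 (by linarith))
  · intro m hm m' hm' hne
    rw [Function.onFun, Finset.disjoint_left]
    intro θ h1 h2
    simp only [Finset.mem_insert, Finset.mem_singleton] at h1 h2
    obtain ⟨k1, k2, k3, -⟩ := hT m hm
    obtain ⟨l1, l2, l3, -⟩ := hT m' hm'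
    have a1 := ((hu m hm (u m)).1 (Or.inl rfl)).1
    have a2 := ((hu m hm (v m)).1 (Or.inr rfl)).1
    have a3 := ((hu m' hm' (u m')).1 (Or.inl rfl)).1
    have a4 := ((hu m' hm' (v m')).1 (Or.inr rfl)).1
    rcases h1 with rfl | rfl <;> rcases h2 with h2 | h2
    · exact hne (angle_param_unique k1 k2 l1 l2 a1 a3 (by linarith))
    · exact hne (angle_param_unique k1 k2 l1 l2 a1 a4 (by linarith))
    · exact hne (angle_param_unique k1 k2 l1 l2 a2 a3 (by linarith))
    · exact hne (angle_param_unique k1 k2 l1 l2 a2 a4 (by linarith))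

end upper

section realAxis

variable {n : ℕ} {c : ℝ}

lemma encard_pos_real (hn : 1 ≤ n) (hc : 0 < c) :
    {x : ℝ | 0 < x ∧ x ^ (n + 1) / (n + 1) - (x ^ n)⁻¹ / n = c}.encard = 1 := by
  have hn0 : (0 : ℝ) < n := by exact_mod_cast hn
  have hn1 : (1 : ℝ) ≤ n := by exact_mod_cast hn
  have hmono : StrictMonoOn (fun x : ℝ => x ^ (n + 1) / (n + 1) - (x ^ n)⁻¹ / n) (Ioi 0) := by
    intro x hx y hy hxy
    have hx' : 0 < x := hx
    have h1 : x ^ (n + 1) / ((n : ℝ) + 1) < y ^ (n + 1) / (n + 1) := by gcongr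
    have h2 : (y ^ n)⁻¹ / (n : ℝ) ≤ (x ^ n)⁻¹ / n := by gcongr
    simp only
    linarith
  have hcont : ContinuousOn (fun x : ℝ => x ^ (n + 1) / (n + 1) - (x ^ n)⁻¹ / n)
      (Icc 1 (3 + c)) := by
    refine ContinuousOn.sub (by fun_prop) (ContinuousOn.div_const (ContinuousOn.inv₀ (by fun_prop)
      fun x hx => pow_ne_zero _ (by linarith [hx.1])) _)
  obtain ⟨x, hx, hxc⟩ := intermediate_value_Icc (by linarith : (1 : ℝ) ≤ 3 + c) hcont
    (show c ∈ Icc _ _ by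
      constructor
      · simp only [one_pow, inv_one]
        have : 1 / ((n : ℝ) + 1) < 1 / n := div_lt_div_of_pos_left one_pos hn0 (by linarith)
        linarith
      · have h1 := one_add_mul_le_pow (by linarith : (-2 : ℝ) ≤ 2 + c) (n + 1)
        rw [show 1 + (2 + c) = 3 + c by ring] at h1
        push_cast at h1
        have h2 : 2 + c ≤ (3 + c) ^ (n + 1) / (n + 1) := by
          rw [le_div_iff₀ (by positivity)]
          linarith
        have h3 : ((3 + c) ^ n)⁻¹ / (n : ℝ) ≤ 1 := by
          rw [div_le_one hn0]
          exact (inv_le_one_of_one_le₀ (one_le_pow₀ (by linarith))).trans hn1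
        linarith)
  rw [encard_eq_one]
  refine ⟨x, eq_singleton_iff_unique_mem.2 ⟨⟨by linarith [hx.1], hxc⟩, fun y hy => ?_⟩⟩
  exact hmono.injOn hy.1 (show 0 < x by linarith [hx.1]) (hy.2.trans hxc.symm)

lemma neg_real_eq_empty_of_even (hn : Even n) (hc : 0 < c) :
    {x : ℝ | x < 0 ∧ x ^ (n + 1) / (n + 1) - (x ^ n)⁻¹ / n = c} = ∅ := by
  rw [eq_empty_iff_forall_notMem]
  rintro x ⟨hx, h⟩
  have h1 : x ^ (n + 1) / ((n : ℝ) + 1) ≤ 0 :=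
    div_nonpos_of_nonpos_of_nonneg (hn.add_one.pow_nonpos hx.le) (by positivity)
  have h2 : 0 ≤ (x ^ n)⁻¹ / (n : ℝ) := div_nonneg (inv_nonneg.2 (hn.pow_nonneg x)) (by positivity)
  linarith

lemma neg_real_eq_image_of_odd (hn : Odd n) (c : ℝ) :
    {x : ℝ | x < 0 ∧ x ^ (n + 1) / (n + 1) - (x ^ n)⁻¹ / n = c} =
      Neg.neg '' {r : ℝ | 0 < r ∧ r ^ (n + 1) / (n + 1) + (r ^ n)⁻¹ / n = c} := by
  have h : ∀ x : ℝ, x ^ (n + 1) / (n + 1) - (x ^ n)⁻¹ / n =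
      (-x) ^ (n + 1) / (n + 1) + ((-x) ^ n)⁻¹ / n := by
    intro x
    rw [hn.add_one.neg_pow, hn.neg_pow, inv_neg]
    ring
  ext x
  simp only [mem_ofPred_eq, mem_image, h]
  constructor
  · rintro ⟨h1, h2⟩
    exact ⟨-x, ⟨by linarith, h2⟩, neg_neg x⟩
  · rintro ⟨r, ⟨h1, h2⟩, rfl⟩
    rw [neg_neg]
    exact ⟨by linarith, h2⟩

lemma encard_neg_real_of_lt (hn : Odd n) (hc : c < 1 / (n + 1) + 1 / n) :
    {x : ℝ | x < 0 ∧ x ^ (n + 1) / (n + 1) - (x ^ n)⁻¹ / n = c}.encard = 0 := by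
  have hn0 : (0 : ℝ) < n := by exact_mod_cast hn.pos
  rw [neg_real_eq_image_of_odd hn, encard_eq_zero, image_eq_empty, eq_empty_iff_forall_notMem]
  rintro r ⟨hr, h⟩
  have hr' : 0 < r⁻¹ := inv_pos.2 hr
  have h1 := one_add_mul_le_pow (by linarith : -2 ≤ r - 1) (n + 1)
  have h2 := one_add_mul_le_pow (by linarith : -2 ≤ r⁻¹ - 1) n
  rw [add_sub_cancel] at h1 h2
  rw [inv_pow] at h2
  push_cast at h1
  have h3 : 1 / ((n : ℝ) + 1) + (r - 1) ≤ r ^ (n + 1) / (n + 1) := by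
    rw [le_div_iff₀ (by positivity), add_mul, div_mul_cancel₀ _ (by positivity)]
    linarith
  have h4 : 1 / (n : ℝ) + (r⁻¹ - 1) ≤ (r ^ n)⁻¹ / n := by
    rw [le_div_iff₀ hn0, add_mul, div_mul_cancel₀ _ hn0.ne']
    linarith
  have h5 : 2 ≤ r + r⁻¹ := by
    have e : r * r⁻¹ = 1 := mul_inv_cancel₀ hr.ne'
    nlinarith [sq_nonneg (r - r⁻¹)]
  linarith

lemma encard_neg_real_of_gt (hn : Odd n) (hc : 1 / (n + 1) + 1 / n < c) :
    {x : ℝ | x < 0 ∧ x ^ (n + 1) / (n + 1) - (x ^ n)⁻¹ / n = c}.encard = 2 := by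
  have hn0 : (0 : ℝ) < n := by exact_mod_cast hn.pos
  have hn1 : (1 : ℝ) ≤ n := by exact_mod_cast hn.pos
  rw [neg_real_eq_image_of_odd hn, neg_injective.encard_image]
  set g : ℝ → ℝ := fun r => r ^ (n + 1) / (n + 1) + (r ^ n)⁻¹ / n with hg
  have hc0 : 0 < c := lt_trans (by positivity) hc
  have hconc : StrictConcaveOn ℝ (Ioi 0) fun r => -g r := by
    have h1 : StrictConvexOn ℝ (Ioi 0) fun r : ℝ => r ^ ((n + 1 : ℕ) : ℤ) :=
      strictConvexOn_zpow (by omega) (by have := hn.pos; omega)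
    have h2 : StrictConvexOn ℝ (Ioi 0) fun r : ℝ => r ^ (-(n : ℤ)) :=
      strictConvexOn_zpow (by have := hn.pos; omega) (by omega)
    have hsmul : ∀ {k : ℝ} {f : ℝ → ℝ}, 0 < k → StrictConvexOn ℝ (Ioi 0) f →
        StrictConvexOn ℝ (Ioi 0) fun r => k * f r := by
      refine fun {k f} hk hf => ⟨hf.1, fun x hx y hy hxy s t hs ht hst => ?_⟩
      have := mul_lt_mul_of_pos_left (hf.2 hx hy hxy hs ht hst) hk
      simp only [smul_eq_mul] at this ⊢
      linarith
    have h3 := (hsmul (by positivity : 0 < ((n : ℝ) + 1)⁻¹) h1).add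
      (hsmul (by positivity : 0 < (n : ℝ)⁻¹) h2)
    refine (h3.neg).congr fun r _ => ?_
    simp only [hg, Pi.neg_apply, Pi.add_apply, div_eq_inv_mul, zpow_neg, zpow_natCast]
  have hcont : ContinuousOn g (Ioi 0) := by
    refine ContinuousOn.add (by fun_prop) (ContinuousOn.div_const (ContinuousOn.inv₀ (by fun_prop)
      fun x hx => pow_ne_zero _ (ne_of_gt hx)) _)
  have hg1 : g 1 < c := by simpa [hg] using hc
  have hbig : c < g (1 + c) := by
    have h1 := one_add_mul_le_pow (by linarith : (-2 : ℝ) ≤ c) (n + 1)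
    push_cast at h1
    have h2 : c < (1 + c) ^ (n + 1) / (n + 1) := by
      rw [lt_div_iff₀ (by positivity)]
      linarith
    have h3 : 0 < ((1 + c) ^ n)⁻¹ / (n : ℝ) := by positivity
    simp only [hg]
    linarith
  have hsmall : c < g (1 + c)⁻¹ := by
    have h1 := one_add_mul_le_pow (by linarith : (-2 : ℝ) ≤ c) n
    have h2 : c < (((1 + c)⁻¹) ^ n)⁻¹ / n := by
      rw [lt_div_iff₀ hn0, inv_pow, inv_inv]
      linarith
    have h3 : 0 < ((1 + c)⁻¹) ^ (n + 1) / ((n : ℝ) + 1) := by positivity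
    simp only [hg]
    linarith
  have hle : (1 + c)⁻¹ ≤ 1 := inv_le_one_of_one_le₀ (by linarith)
  have hipos : 0 < (1 + c)⁻¹ := by positivity
  obtain ⟨u, hu, huc⟩ := intermediate_value_Ioo' hle
    (hcont.mono fun x hx => hipos.trans_le hx.1) ⟨hg1, hsmall⟩
  obtain ⟨v, hv, hvc⟩ := intermediate_value_Ioo (by linarith : 1 ≤ 1 + c)
    (hcont.mono fun x hx => one_pos.trans_le hx.1) ⟨hg1, hbig⟩
  have hu0 : 0 < u := hipos.trans hu.1
  have hv0 : 0 < v := one_pos.trans hv.1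
  have huv : u < v := hu.2.trans hv.1
  rw [encard_eq_two]
  refine ⟨u, v, huv.ne, ?_⟩
  ext w
  constructor
  · rintro ⟨hw, hwc⟩
    have hwc' : g w = c := hwc
    exact hconc.eq_or_eq_of_eq hu0 hv0 hw huv (by simp only [huc, hvc]) (by simp only [huc, hwc'])
  · rintro (rfl | rfl)
    · exact ⟨hu0, huc⟩
    · exact ⟨hv0, hvc⟩

end realAxis

/-- Splitting the zeros into positive, negative, and a conjugate pair of half planes. -/
lemma ncard_zeros {n : ℕ} (hn : 1 ≤ n) {a : ℝ} (ha : 1 < a) {k t : ℕ}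
    (hk : {x : ℝ | x < 0 ∧ x ^ (n + 1) / (n + 1) - (x ^ n)⁻¹ / n = 1 / (a + 1)}.encard = k)
    (ht : {z : ℂ | 0 < z.im ∧ zeroMap n z = ((1 / (a + 1) : ℝ) : ℂ)}.encard = (2 * t : ℕ)) :
    {z : ℂ | z ≠ 0 ∧ fa n a z = 0}.ncard = 1 + k + 4 * t := by
  set c := 1 / (a + 1)
  have hc : 0 < c := div_pos one_pos (by linarith)
  set P := {x : ℝ | 0 < x ∧ x ^ (n + 1) / (n + 1) - (x ^ n)⁻¹ / n = c}
  set Q := {x : ℝ | x < 0 ∧ x ^ (n + 1) / (n + 1) - (x ^ n)⁻¹ / n = c}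
  set U := {z : ℂ | 0 < z.im ∧ zeroMap n z = (c : ℂ)}
  have hP : P.encard = 1 := encard_pos_real hn hc
  have hset : {z : ℂ | z ≠ 0 ∧ fa n a z = 0} =
      Complex.ofReal '' (P ∪ Q) ∪ (U ∪ starRingEnd ℂ '' U) := by
    ext z
    simp only [mem_ofPred_eq, fa_eq_zero_iff ha]
    constructor
    · rintro ⟨hz0, hz⟩
      rcases lt_trichotomy z.im 0 with h | h | h
      · refine Or.inr (Or.inr ⟨starRingEnd ℂ z, ⟨by simpa using h, ?_⟩, Complex.conj_conj z⟩)
        rw [zeroMap_conj, hz, Complex.conj_ofReal]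
      · obtain ⟨x, rfl⟩ : ∃ x : ℝ, z = x := ⟨z.re, Complex.ext (by simp) (by simpa using h)⟩
        rw [zeroMap_ofReal, Complex.ofReal_inj] at hz
        refine Or.inl ⟨x, ?_, rfl⟩
        rcases lt_or_gt_of_ne (Complex.ofReal_ne_zero.1 hz0) with h | h
        · exact Or.inr ⟨h, hz⟩
        · exact Or.inl ⟨h, hz⟩
      · exact Or.inr (Or.inl ⟨h, hz⟩)
    · rintro (⟨x, hx, rfl⟩ | h | ⟨w, h, rfl⟩)
      · rw [zeroMap_ofReal, Complex.ofReal_inj, Complex.ofReal_ne_zero]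
        rcases hx with hx | hx
        · exact ⟨hx.1.ne', hx.2⟩
        · exact ⟨hx.1.ne, hx.2⟩
      · refine ⟨?_, h.2⟩
        rintro rfl
        exact lt_irrefl _ h.1
      · refine ⟨?_, ?_⟩
        · intro h0
          rw [map_eq_zero] at h0
          rw [h0] at h
          exact lt_irrefl _ h.1
        · rw [zeroMap_conj, h.2, Complex.conj_ofReal]
  have hd1 : Disjoint P Q := disjoint_left.2 fun x h1 h2 => lt_asymm h1.1 h2.1
  have hd2 : Disjoint U (starRingEnd ℂ '' U) := by
    rw [disjoint_left]
    rintro _ h1 ⟨w, h2, rfl⟩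
    have h3 := h1.1
    rw [Complex.conj_im] at h3
    linarith [h2.1]
  have hd3 : Disjoint (Complex.ofReal '' (P ∪ Q)) (U ∪ starRingEnd ℂ '' U) := by
    rw [disjoint_left]
    rintro _ ⟨x, -, rfl⟩ (h | ⟨w, h, h'⟩)
    · exact lt_irrefl _ h.1
    · have h1 := congrArg Complex.im h'
      rw [Complex.conj_im, Complex.ofReal_im] at h1
      linarith [h.1]
  rw [ncard_def, hset, encard_union_eq hd3, encard_union_eq hd2,
    Complex.ofReal_injective.encard_image, encard_union_eq hd1,
    (starRingEnd ℂ).injective.encard_image U, hP, hk, ht]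
  norm_cast
  rw [ENat.toNat_natCast]
  ring

/-- The indices of the right parity are `2 * i - e` for `1 ≤ i ≤ p`; if the level lies between the
critical values number `l` and `l + 1`, then `p - l` of them contribute two zeros each. -/
lemma encard_upper_of_between {n p e l : ℕ} (he : e ≤ 1) (hn : n + e = 2 * p + 1) {y : ℕ → ℝ}
    (hmono : ∀ m, 1 ≤ m → m + 1 < n → y m < y (m + 1))
    (hle : ∀ m, 1 ≤ m → m < n → ∀ x ∈ Ioo (π / (n + 1)) (π / n),
      (n + 1) ^ n * n ^ (n + 1) * angleRatio n m x ≤ y m ^ (2 * n + 1))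
    (hpair : ∀ m, 1 ≤ m → m < n → ∀ b, 0 < b → b < y m → ∃ u v, u ≠ v ∧
      {x ∈ Ioo (π / (n + 1)) (π / n) |
        (n + 1) ^ n * n ^ (n + 1) * angleRatio n m x = b ^ (2 * n + 1)} = {u, v})
    (hpos : ∀ m, 1 ≤ m → m < n → 0 < y m)
    {b : ℝ} (hb : 0 < b) (hl : l ≤ p) (hlo : 1 ≤ l → y (2 * l - e) < b)
    (hhi : l < p → b < y (2 * (l + 1) - e)) :
    {z : ℂ | 0 < z.im ∧ zeroMap n z = ((1 / b : ℝ) : ℂ)}.encard = (2 * (p - l) : ℕ) := by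
  have hmono' : ∀ m m', 1 ≤ m → m ≤ m' → m' < n → y m ≤ y m' := by
    intro m m' hm hmm'
    induction m', hmm' using Nat.le_induction with
    | base => exact fun _ => le_rfl
    | succ k hk ih => exact fun h => (ih (by omega)).trans (hmono k (by omega) h).le
  have hcard : ((Finset.Ioc l p).image fun i => 2 * i - e).card = p - l := by
    rw [Finset.card_image_of_injOn, Nat.card_Ioc]
    intro i hi j hj h
    simp only [Finset.coe_Ioc, mem_Ioc] at hi hj h
    omega
  rw [← hcard]
  refine encard_upper hb _ (fun m hm => ?_) fun m h1 h2 hodd hm x hx => ?_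
  · simp only [Finset.mem_image, Finset.mem_Ioc] at hm
    obtain ⟨i, ⟨hi1, hi2⟩, rfl⟩ := hm
    refine ⟨by omega, by omega, ⟨p + i - e, by omega⟩, hpair _ (by omega) (by omega) b hb ?_⟩
    exact (hhi (by omega)).trans_le (hmono' _ _ (by omega) (by omega) (by omega))
  · obtain ⟨q, hq⟩ := hodd
    have hil : (m + e) / 2 ≤ l := by
      by_contra! h
      exact hm (Finset.mem_image.2 ⟨(m + e) / 2, Finset.mem_Ioc.2 ⟨h, by omega⟩, by omega⟩)
    have hlt : y m < b :=
      (hmono' m (2 * l - e) h1 (by omega) (by omega)).trans_lt (hlo (by omega))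
    exact ((hle m h1 h2 x hx).trans_lt (pow_lt_pow_left₀ hlt (hpos m h1 h2).le (by omega))).ne

/-- Main zero-counting theorem: with `N = ⌊(n+1)/2⌋`, there are critical values
`1 < α 1 < α 2 < ⋯ < α N` governing the number of zeros of `f_a`. -/
theorem main_zero_count (n : ℕ) (hn : 4 ≤ n) :
    ∃ α : ℕ → ℝ, 1 < α 1 ∧
      (∀ j : ℕ, 1 ≤ j → j < (n + 1) / 2 → α j < α (j + 1)) ∧
      (∀ a : ℝ, 1 < a → a < α 1 →
        {z : ℂ | z ≠ 0 ∧ fa n a z = 0}.ncard = 2 * n + 1) ∧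
      (∀ j : ℕ, 1 ≤ j → j < (n + 1) / 2 → ∀ a : ℝ, α j < a → a < α (j + 1) →
        {z : ℂ | z ≠ 0 ∧ fa n a z = 0}.ncard =
          if Even n then 2 * n - 4 * j + 1 else 2 * n - 4 * j + 3) ∧
      (∀ a : ℝ, α ((n + 1) / 2) < a →
        {z : ℂ | z ≠ 0 ∧ fa n a z = 0}.ncard = 1) := by
  obtain ⟨y, hpos, hmono, hle, hpair⟩ := exists_critical_values n
  rcases Nat.even_or_odd n with heven | hodd
  · obtain ⟨p, hp⟩ := heven.two_dvd
    have hy1 : 2 < y 1 := two_lt_of_le hn (hpos 1 le_rfl (by omega))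
      (le_of_angleRatio_le le_rfl (by omega) (hle 1 le_rfl (by omega)))
    have hstep : ∀ j : ℕ, 1 ≤ j → j < p → y (2 * j - 1) < y (2 * (j + 1) - 1) := by
      intro j h1 h2
      have k1 := hmono (2 * j - 1) (by omega) (by omega)
      have k2 := hmono (2 * j - 1 + 1) (by omega) (by omega)
      rw [show 2 * (j + 1) - 1 = 2 * j - 1 + 1 + 1 by omega]
      exact k1.trans k2
    have hcount : ∀ l ≤ p, ∀ a : ℝ, 1 < a → (1 ≤ l → y (2 * l - 1) < a + 1) →
        (l < p → a + 1 < y (2 * (l + 1) - 1)) →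
        {z : ℂ | z ≠ 0 ∧ fa n a z = 0}.ncard = 1 + 0 + 4 * (p - l) := by
      intro l hl a ha hlo hhi
      refine ncard_zeros (by omega) ha ?_ (encard_upper_of_between le_rfl (by omega) hmono hle
        hpair hpos (by linarith) hl hlo hhi)
      rw [neg_real_eq_empty_of_even heven (div_pos one_pos (by linarith)), encard_empty]
      rfl
    have hgt : ∀ j : ℕ, 1 ≤ j → j ≤ p → 2 < y (2 * j - 1) := by
      intro j hj
      induction j, hj using Nat.le_induction with
      | base => exact fun _ => hy1
      | succ k hk ih => exact fun h => (ih (by omega)).trans (hstep k hk (by omega))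
    rw [show (n + 1) / 2 = p by omega]
    simp only [if_pos heven]
    refine ⟨fun j => y (2 * j - 1) - 1, ?_, fun j h1 h2 => ?_, fun a ha h1 => ?_,
      fun j h1 h2 a h3 h4 => ?_, fun a h1 => ?_⟩
    · linarith [hgt 1 le_rfl (by omega)]
    · linarith [hstep j h1 h2]
    · rw [hcount 0 (by omega) a ha (by omega) fun _ => by simp only [zero_add]; linarith]
      omega
    · rw [hcount j h2.le a (by linarith [hgt j h1 h2.le]) (fun _ => by linarith)
        fun _ => by linarith]
      omega
    · rw [hcount p le_rfl a (by linarith [hgt p (by omega) le_rfl]) (fun _ => by linarith) (by omega)]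
      omega
  · obtain ⟨p, hp⟩ := hodd
    have hodd : Odd n := ⟨p, hp⟩
    have hn' : (4 : ℝ) ≤ n := by exact_mod_cast hn
    set β : ℝ := n * (n + 1) / (2 * n + 1) with hβ
    have hβ2 : 2 < β := by
      rw [hβ, lt_div_iff₀ (by positivity)]
      nlinarith
    have hβinv : 1 / ((n : ℝ) + 1) + 1 / n = 1 / β := by
      rw [hβ]
      field_simp
      ring
    have hy2 : β < y 2 := lt_of_le_cos_two hn (hpos 2 (by omega) (by omega))
      (le_of_angleRatio_le (by omega) (by omega) (hle 2 (by omega) (by omega)))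
      (angleRatio_midpoint (by omega) (by omega)).2.1
    have hstep : ∀ l : ℕ, 1 ≤ l → l < p → y (2 * l) < y (2 * (l + 1)) := fun l h1 h2 =>
      (hmono (2 * l) (by omega) (by omega)).trans (hmono (2 * l + 1) (by omega) (by omega))
    have hgt : ∀ l : ℕ, 1 ≤ l → l ≤ p → β < y (2 * l) := by
      intro l hl
      induction l, hl using Nat.le_induction with
      | base => exact fun _ => hy2
      | succ k hk ih => exact fun h => (ih (by omega)).trans (hstep k hk (by omega))
    have hupper : ∀ l ≤ p, ∀ a : ℝ, 1 < a → (1 ≤ l → y (2 * l) < a + 1) →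
        (l < p → a + 1 < y (2 * (l + 1))) →
        {z : ℂ | 0 < z.im ∧ zeroMap n z = ((1 / (a + 1) : ℝ) : ℂ)}.encard =
          (2 * (p - l) : ℕ) := fun l hl a ha hlo hhi =>
      encard_upper_of_between zero_le_one (by omega) hmono hle hpair hpos (by linarith) hl hlo hhi
    have hcount : ∀ l ≤ p, ∀ a : ℝ, β < a + 1 → (1 ≤ l → y (2 * l) < a + 1) →
        (l < p → a + 1 < y (2 * (l + 1))) →
        {z : ℂ | z ≠ 0 ∧ fa n a z = 0}.ncard = 1 + 0 + 4 * (p - l) := by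
      intro l hl a ha hlo hhi
      refine ncard_zeros (by omega) (by linarith) ?_ (hupper l hl a (by linarith) hlo hhi)
      rw [encard_neg_real_of_lt hodd]
      · rfl
      · rw [hβinv]
        exact one_div_lt_one_div_of_lt (by linarith) ha
    let α : ℕ → ℝ := fun j => if j ≤ 1 then β - 1 else y (2 * (j - 1)) - 1
    have hα1 : α 1 = β - 1 := if_pos le_rfl
    have hα : ∀ l, 1 ≤ l → α (l + 1) = y (2 * l) - 1 := fun l hl => if_neg (by omega)
    have hαβ : ∀ j, 1 ≤ j → j ≤ p + 1 → β - 1 ≤ α j := by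
      intro j h1 h2
      rcases h1.eq_or_lt with rfl | h
      · exact hα1.ge
      · obtain ⟨l, rfl⟩ := Nat.exists_eq_add_of_le' h1
        rw [hα l (by omega)]
        linarith [hgt l (by omega) (by omega)]
    rw [show (n + 1) / 2 = p + 1 by omega]
    simp only [if_neg (Nat.not_even_iff_odd.2 hodd)]
    refine ⟨α, by rw [hα1]; linarith, fun j h1 h2 => ?_, fun a ha h1 => ?_,
      fun j h1 h2 a h3 h4 => ?_, fun a h1 => ?_⟩
    · rw [hα j h1]
      rcases h1.eq_or_lt with rfl | h
      · rw [hα1]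
        linarith
      · obtain ⟨l, rfl⟩ := Nat.exists_eq_add_of_le' h1
        rw [hα l (by omega)]
        linarith [hstep l (by omega) (by omega)]
    · rw [hα1] at h1
      rw [ncard_zeros (k := 2) (by omega) ha ?_ (hupper 0 (by omega) a ha (by omega) fun _ => ?_)]
      · omega
      · rw [encard_neg_real_of_gt hodd]
        · rfl
        · rw [hβinv]
          exact one_div_lt_one_div_of_lt (by linarith) (by linarith)
      · simp only [zero_add, mul_one]
        linarith
    · have hjβ := hαβ j h1 h2.le
      rw [hα j h1] at h4
      obtain ⟨l, rfl⟩ := Nat.exists_eq_add_of_le' h1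
      rw [hcount l (by omega) a (by linarith) (fun hl => ?_) fun _ => by linarith]
      · omega
      · rw [hα l hl] at h3
        linarith
    · have hjβ := hαβ (p + 1) (by omega) le_rfl
      rw [hα p (by omega)] at h1 hjβ
      rw [hcount p le_rfl a (by linarith) (fun _ => by linarith) (by omega)]
      omega
end

section
/- Let n ≥ 1 be a natural number and a > 1 a real number. The derivative of the curve γ(θ) = f_a(e^{iθ}) vanishes exactly at integer multiples of 2π: for θ ∈ ℝ, γ'(θ) = 0 if and only if θ = 2πk for some integer k. Equivalently, the curve f_a({|z| = 1}), traversed by θ ↦ f_a(e^{iθ}) for θ ∈ [0, 2π], has exactly one cusp, at θ = 0. -/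
open Complex in
/-- On the unit circle, `f_a` is a trigonometric polynomial. -/
theorem fa_exp_mul_I (n : ℕ) (a t : ℝ) :
    fa n a (exp (t * I)) =
      (a : ℂ) / ((n : ℂ) + 1) * exp (((n : ℂ) + 1) * I * t) - 1 / (n : ℂ) * exp (-(n : ℂ) * I * t) +
        1 / ((n : ℂ) + 1) * exp (-((n : ℂ) + 1) * I * t) - (a : ℂ) / (n : ℂ) * exp ((n : ℂ) * I * t)
        - 1 := by
  have hconj : starRingEnd ℂ (exp (t * I)) = exp (-(t * I)) := by
    rw [← exp_conj, map_mul, conj_ofReal, conj_I, mul_neg]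
  rw [fa, hconj, ← exp_nat_mul, ← exp_nat_mul, ← exp_int_mul, ← exp_int_mul]
  push_cast
  ring_nf

open Complex in
/-- The velocity of the curve `t ↦ f_a(e^{it})`, written in terms of the difference
`e^{i(n+1)t} - e^{int}` and its conjugate. -/
theorem hasDerivAt_fa_exp_mul_I {n : ℕ} (hn : n ≠ 0) (a θ : ℝ) :
    HasDerivAt (fun t : ℝ => fa n a (exp (t * I)))
      (I * (a * (exp (θ * I) ^ (n + 1) - exp (θ * I) ^ n) -
        starRingEnd ℂ (exp (θ * I) ^ (n + 1) - exp (θ * I) ^ n))) θ := by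
  have hn0 : (n : ℂ) ≠ 0 := Nat.cast_ne_zero.mpr hn
  have hn1 : (n : ℂ) + 1 ≠ 0 := Nat.cast_add_one_ne_zero n
  have hexp (c : ℂ) : HasDerivAt (fun t : ℝ => exp (c * t)) (exp (c * θ) * c) θ := by
    simpa using (((hasDerivAt_id (θ : ℂ)).const_mul c).cexp).comp_ofReal
  have hconj : starRingEnd ℂ (exp (θ * I)) = exp (-(θ * I)) := by
    rw [← exp_conj, map_mul, conj_ofReal, conj_I, mul_neg]
  simp only [fa_exp_mul_I]
  refine ((((((hexp _).const_mul _).sub ((hexp _).const_mul _)).add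
    ((hexp _).const_mul _)).sub ((hexp _).const_mul _)).sub_const 1).congr_deriv ?_
  have h₁ : exp (((n : ℂ) + 1) * I * θ) = exp (θ * I) ^ (n + 1) := by
    rw [← exp_nat_mul]; push_cast; ring_nf
  have h₂ : exp ((n : ℂ) * I * θ) = exp (θ * I) ^ n := by
    rw [← exp_nat_mul]; ring_nf
  have h₃ : exp (-((n : ℂ) + 1) * I * θ) = exp (-(θ * I)) ^ (n + 1) := by
    rw [← exp_nat_mul]; push_cast; ring_nf
  have h₄ : exp (-(n : ℂ) * I * θ) = exp (-(θ * I)) ^ n := by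
    rw [← exp_nat_mul]; ring_nf
  rw [h₁, h₂, h₃, h₄, map_sub, map_pow, map_pow, hconj]
  field_simp
  ring

/-- Multiplication by a real number larger than `1` agrees with conjugation only at `0`. -/
theorem ofReal_mul_eq_conj_iff {a : ℝ} (ha : 1 < a) (d : ℂ) :
    (a : ℂ) * d = starRingEnd ℂ d ↔ d = 0 := by
  refine ⟨fun h => ?_, fun h => by simp [h]⟩
  have hnorm := congrArg norm h
  rw [norm_mul, Complex.norm_real, RCLike.norm_conj, Real.norm_of_nonneg (by linarith)] at hnorm
  exact norm_eq_zero.mp (by nlinarith [norm_nonneg d])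

/-- The derivative of the curve `γ(θ) = f_a(e^{iθ})` vanishes exactly at integer multiples
of `2π`: the curve has exactly one cusp, at `θ = 0` (mod `2π`). -/
theorem cusp_of_image_curve (n : ℕ) (hn : 1 ≤ n) (a : ℝ) (ha : 1 < a) (θ : ℝ) :
    deriv (fun t : ℝ => fa n a (Complex.exp (t * Complex.I))) θ = 0 ↔
      ∃ k : ℤ, θ = 2 * Real.pi * k := by
  rw [(hasDerivAt_fa_exp_mul_I (by omega) a θ).deriv, mul_eq_zero_iff_left Complex.I_ne_zero,
    sub_eq_zero, ofReal_mul_eq_conj_iff ha, pow_succ, ← mul_sub_one,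
    mul_eq_zero_iff_left (pow_ne_zero n (Complex.exp_ne_zero _)), sub_eq_zero,
    Complex.exp_eq_one_iff]
  refine exists_congr fun k => ?_
  rw [← mul_assoc, mul_left_inj' Complex.I_ne_zero, mul_comm (k : ℂ)]
  norm_cast
end

section
/- Let n ≥ 4 be a natural number and a > 1 a real number. The set of intersections of the curve f_a({|z| = 1}) with the real axis that lie strictly to the right of its center −1, namely {w ∈ ℂ : Im w = 0, Re w > −1, and w = f_a(e^{iθ}) for some θ ∈ ℝ}, has exactly ⌊(n+1)/2⌋ elements. -/
open Real Set

/-- Up to the factor `a - 1`, the imaginary part of `fa n a` on the unit circle. -/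
noncomputable def circleIm (n : ℕ) (θ : ℝ) : ℝ :=
  sin ((n + 1) * θ) / (n + 1) - sin (n * θ) / n

/-- Up to the factor `a + 1` and the shift by `-1`, the real part of `fa n a` on the unit circle. -/
noncomputable def circleRe (n : ℕ) (θ : ℝ) : ℝ :=
  cos ((n + 1) * θ) / (n + 1) - cos (n * θ) / n

theorem fa_exp (n : ℕ) (a θ : ℝ) :
    fa n a (Complex.exp (θ * Complex.I)) =
      ⟨(a + 1) * circleRe n θ - 1, (a - 1) * circleIm n θ⟩ := by
  have h1 : Complex.exp (θ * Complex.I) ^ (n + 1) =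
      Complex.cos (((n + 1) * θ : ℝ)) + Complex.sin (((n + 1) * θ : ℝ)) * Complex.I := by
    rw [← Complex.exp_mul_I, ← Complex.exp_nat_mul]
    push_cast
    ring_nf
  have h2 : Complex.exp (θ * Complex.I) ^ (-(n : ℤ)) =
      Complex.cos ((n * θ : ℝ)) - Complex.sin ((n * θ : ℝ)) * Complex.I := by
    rw [← Complex.exp_int_mul, ← Complex.cos_neg, sub_eq_add_neg, ← neg_mul, ← Complex.sin_neg,
      ← Complex.exp_mul_I]
    push_cast
    ring_nf
  rw [fa, ← map_pow, ← map_zpow₀, h1, h2, ← Complex.ofReal_cos, ← Complex.ofReal_cos,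
    ← Complex.ofReal_sin, ← Complex.ofReal_sin]
  rw [Complex.mk_eq_add_mul_I, circleRe, circleIm]
  simp only [map_add, map_sub, map_mul, Complex.conj_ofReal, Complex.conj_I]
  push_cast
  ring

/-- On the circle the squared modulus is an affine function of `cos θ`. -/
theorem circleRe_sq_add_circleIm_sq (n : ℕ) (θ : ℝ) :
    circleRe n θ ^ 2 + circleIm n θ ^ 2 =
      (1 / ((n : ℝ) + 1)) ^ 2 + (1 / (n : ℝ)) ^ 2 - 2 * (1 / (n + 1)) * (1 / n) * cos θ := by
  have h : cos θ = cos ((n + 1) * θ) * cos (n * θ) + sin ((n + 1) * θ) * sin (n * θ) := by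
    rw [← cos_sub]
    ring_nf
  have h1 := sin_sq_add_cos_sq ((n + 1) * θ)
  have h2 := sin_sq_add_cos_sq (n * θ)
  rw [h, circleRe, circleIm]
  linear_combination (1 / ((n : ℝ) + 1)) ^ 2 * h1 + (1 / (n : ℝ)) ^ 2 * h2

theorem exists_mem_Icc_circle_eq (n : ℕ) (t : ℝ) :
    ∃ θ ∈ Icc 0 π, circleRe n t = circleRe n θ ∧ (circleIm n t = 0 → circleIm n θ = 0) := by
  refine ⟨arccos (cos t), ⟨arccos_nonneg _, arccos_le_pi _⟩, ?_⟩
  have h := cos_arccos (neg_one_le_cos t) (cos_le_one t)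
  generalize arccos (cos t) = θ at h
  obtain ⟨k, rfl | rfl⟩ := Real.cos_eq_cos_iff.1 h
  · have e1 : ((n : ℝ) + 1) * (2 * k * π + θ) =
        (n + 1) * θ + (((n + 1) * k : ℤ) : ℝ) * (2 * π) := by push_cast; ring
    have e2 : (n : ℝ) * (2 * k * π + θ) = n * θ + ((n * k : ℤ) : ℝ) * (2 * π) := by
      push_cast; ring
    simp only [circleRe, circleIm, e1, e2, cos_add_int_mul_two_pi, sin_add_int_mul_two_pi]
    exact ⟨trivial, id⟩
  · have e1 : ((n : ℝ) + 1) * (2 * k * π - θ) =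
        -((n + 1) * θ) + (((n + 1) * k : ℤ) : ℝ) * (2 * π) := by push_cast; ring
    have e2 : (n : ℝ) * (2 * k * π - θ) = -(n * θ) + ((n * k : ℤ) : ℝ) * (2 * π) := by
      push_cast; ring
    simp only [circleRe, circleIm, e1, e2, cos_add_int_mul_two_pi, sin_add_int_mul_two_pi,
      cos_neg, sin_neg]
    exact ⟨trivial, fun h => by linear_combination -h⟩

/-- The critical points `2πk/(2n+1)` of `circleIm n`. -/
noncomputable def critPt (n k : ℕ) : ℝ := 2 * π * k / (2 * n + 1)

theorem critPt_nonneg (n k : ℕ) : 0 ≤ critPt n k := by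
  have := pi_pos
  unfold critPt
  positivity

theorem mul_critPt (n k : ℕ) : n * critPt n k = k * π - critPt n k / 2 := by
  unfold critPt
  field_simp
  ring

theorem critPt_lt_pi {n k : ℕ} (hk : k ≤ n) : critPt n k < π := by
  have hk' : (k : ℝ) ≤ n := by exact_mod_cast hk
  rw [critPt, div_lt_iff₀ (by positivity)]
  nlinarith [pi_pos]

theorem pi_lt_critPt (n : ℕ) : π < critPt n (n + 1) := by
  rw [critPt, lt_div_iff₀ (by positivity)]
  push_cast
  nlinarith [pi_pos]

theorem hasDerivAt_circleIm {n : ℕ} (hn : 0 < n) (θ : ℝ) :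
    HasDerivAt (circleIm n) (-2 * sin ((2 * n + 1) * θ / 2) * sin (θ / 2)) θ := by
  have hn' : (n : ℝ) ≠ 0 := by positivity
  have hn1 : (n : ℝ) + 1 ≠ 0 := by positivity
  have h1 := ((((hasDerivAt_id θ).const_mul ((n : ℝ) + 1)).sin).div_const ((n : ℝ) + 1)).sub
    ((((hasDerivAt_id θ).const_mul (n : ℝ)).sin).div_const (n : ℝ))
  refine h1.congr_deriv ?_
  have := cos_sub_cos ((n + 1) * θ) (n * θ)
  simp only [id, mul_one, mul_div_assoc, div_self hn', div_self hn1]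
  rw [this]
  ring_nf

theorem strictAntiOn_circleIm {n k : ℕ} (hn : 0 < n) (hk : k ≤ n) :
    StrictAntiOn (fun θ => (-1) ^ k * circleIm n θ) (Icc (critPt n k) (critPt n (k + 1))) := by
  have hd := fun θ => (hasDerivAt_circleIm hn θ).const_mul ((-1 : ℝ) ^ k)
  refine strictAntiOn_of_deriv_neg (convex_Icc _ _)
    (fun θ _ => (hd θ).continuousAt.continuousWithinAt) fun θ hθ => ?_
  rw [interior_Icc] at hθ
  rw [(hd θ).deriv]
  have hθ0 : 0 < θ := (critPt_nonneg n k).trans_lt hθ.1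
  have h1 := hθ.1
  have h2 := hθ.2
  rw [critPt, div_lt_iff₀ (by positivity)] at h1
  rw [critPt, lt_div_iff₀ (by positivity)] at h2
  push_cast at h2
  have hk' : (k : ℝ) ≤ n := by exact_mod_cast hk
  have hn' : (1 : ℝ) ≤ n := by exact_mod_cast hn
  have hθ2 : θ < 2 * π := by nlinarith [pi_pos]
  have hs := sin_sub_nat_mul_pi ((2 * n + 1) * θ / 2) k
  have hp : 0 < sin ((2 * n + 1) * θ / 2 - k * π) :=
    sin_pos_of_pos_of_lt_pi (by linarith) (by linarith)
  have hq : 0 < sin (θ / 2) := sin_pos_of_pos_of_lt_pi (by linarith) (by linarith)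
  rw [hs] at hp
  nlinarith [mul_pos hp hq]

theorem circleIm_critPt_nonneg {n k : ℕ} (hk : k ≤ n) :
    0 ≤ (-1) ^ k * circleIm n (critPt n k) := by
  have h1 := sin_sub_nat_mul_pi (n * critPt n k) k
  have h2 := sin_sub_nat_mul_pi ((n + 1) * critPt n k) k
  have e1 : n * critPt n k - k * π = -(critPt n k / 2) := by linarith [mul_critPt n k]
  have e2 : (n + 1) * critPt n k - k * π = critPt n k / 2 := by linarith [mul_critPt n k]
  have h0 := critPt_nonneg n k
  have h3 : 0 ≤ sin (critPt n k / 2) :=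
    sin_nonneg_of_nonneg_of_le_pi (by linarith) (by linarith [critPt_lt_pi hk])
  rw [e1, sin_neg] at h1
  rw [e2] at h2
  have : (-1) ^ k * circleIm n (critPt n k) =
      sin (critPt n k / 2) / (n + 1) + sin (critPt n k / 2) / n := by
    rw [circleIm]
    linear_combination -h2 / ((n : ℝ) + 1) + h1 / (n : ℝ)
  rw [this]
  positivity

theorem circleIm_half_neg {n : ℕ} (hn : 0 < n) (k : ℕ) :
    (-1) ^ k * circleIm n ((k + 1 / 2) * π / n) < 0 := by
  have hn' : (0 : ℝ) < n := by exact_mod_cast hn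
  set u : ℝ := (k + 1 / 2) * π / n with hu
  have hnu : n * u = (k + 1 / 2) * π := by rw [hu]; field_simp
  have h1 := sin_sub_nat_mul_pi (n * u) k
  have h2 := sin_sub_nat_mul_pi ((n + 1) * u) k
  have e1 : n * u - k * π = π / 2 := by linarith
  have e2 : (n + 1) * u - k * π = u + π / 2 := by linarith
  rw [e1, sin_pi_div_two] at h1
  rw [e2, sin_add_pi_div_two] at h2
  have : (-1) ^ k * circleIm n u = cos u / (n + 1) - 1 / n := by
    rw [circleIm]
    linear_combination -h2 / ((n : ℝ) + 1) + h1 / (n : ℝ)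
  rw [this, sub_neg]
  calc cos u / (n + 1) ≤ 1 / (n + 1) := by gcongr; exact cos_le_one u
    _ < 1 / n := by gcongr; linarith

theorem half_mem_Ioo {n k : ℕ} (hk : k < n) :
    (k + 1 / 2) * π / n ∈ Ioo (critPt n k) (critPt n (k + 1)) := by
  have hk' : (k : ℝ) + 1 ≤ n := by exact_mod_cast hk
  have hk0 : (0 : ℝ) ≤ k := by positivity
  have hn' : (0 : ℝ) < n := by linarith
  constructor
  · rw [critPt, div_lt_div_iff₀ (by positivity) hn']
    nlinarith [pi_pos]
  · rw [critPt, div_lt_div_iff₀ hn' (by positivity)]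
    push_cast
    nlinarith [pi_pos]

theorem cos_pos_of_circleIm_eq_zero {n k : ℕ} (hn : 0 < n) (hk : k ≤ n) {θ : ℝ}
    (hθ : θ ∈ Icc (critPt n k) (critPt n (k + 1))) (hπ : θ ≤ π) (h0 : circleIm n θ = 0) :
    0 < (-1) ^ k * cos (n * θ) := by
  have hn' : (0 : ℝ) < n := by exact_mod_cast hn
  rw [← cos_sub_nat_mul_pi]
  apply cos_pos_of_mem_Ioo
  constructor
  · have := mul_le_mul_of_nonneg_left hθ.1 hn'.le
    rw [mul_critPt] at this
    linarith [critPt_lt_pi hk]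
  · rcases hk.eq_or_lt with rfl | hk
    · nlinarith [pi_pos]
    · by_contra! h
      have hu := half_mem_Ioo hk
      have hle : (k + 1 / 2) * π / n ≤ θ := by
        rw [div_le_iff₀ hn']
        linarith
      have := (strictAntiOn_circleIm hn hk.le).antitoneOn (Ioo_subset_Icc_self hu) hθ hle
      simp only [h0, mul_zero] at this
      linarith [circleIm_half_neg hn k]

theorem circleRe_neg_of_cos_pos {n : ℕ} (hn : 0 < n) {s θ : ℝ} (hs : s ^ 2 = 1)
    (h0 : circleIm n θ = 0) (hc : 0 < s * cos (n * θ)) : s * circleRe n θ < 0 := by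
  have hn' : (0 : ℝ) < n := by exact_mod_cast hn
  by_contra! h
  have h1 := sin_sq_add_cos_sq ((n + 1) * θ)
  have h2 := sin_sq_add_cos_sq (n * θ)
  have hle : s * cos (n * θ) / n ≤ s * cos ((n + 1) * θ) / (n + 1) := by
    have : s * circleRe n θ = s * cos ((n + 1) * θ) / (n + 1) - s * cos (n * θ) / n := by
      rw [circleRe]; ring
    linarith
  have hsq := pow_le_pow_left₀ (by positivity) hle 2
  have hsin : sin ((n + 1) * θ) / (n + 1) = sin (n * θ) / n := sub_eq_zero.1 h0
  have hlt : (1 / ((n : ℝ) + 1)) ^ 2 < (1 / (n : ℝ)) ^ 2 := by gcongr; linarith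
  have e1 : (s * cos (n * θ) / n) ^ 2 = (1 / (n : ℝ)) ^ 2 - (sin (n * θ) / n) ^ 2 := by
    linear_combination (cos (n * θ) / n) ^ 2 * hs + (1 / (n : ℝ)) ^ 2 * h2
  have e2 : (s * cos ((n + 1) * θ) / (n + 1)) ^ 2 =
      (1 / ((n : ℝ) + 1)) ^ 2 - (sin ((n + 1) * θ) / (n + 1)) ^ 2 := by
    linear_combination (cos ((n + 1) * θ) / (n + 1)) ^ 2 * hs + (1 / ((n : ℝ) + 1)) ^ 2 * h1
  rw [e1, e2, hsin] at hsq
  linarith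

theorem exists_circleIm_eq_zero {n k : ℕ} (hn : 0 < n) (hk : k ≤ n) :
    ∃ θ ∈ Ico (critPt n k) (critPt n (k + 1)), θ ≤ π ∧ circleIm n θ = 0 := by
  rcases hk.eq_or_lt with rfl | hk
  · refine ⟨π, ⟨(critPt_lt_pi le_rfl).le, pi_lt_critPt k⟩, le_rfl, ?_⟩
    have := sin_nat_mul_pi (k + 1)
    push_cast at this
    simp [circleIm, this, sin_nat_mul_pi]
  · have hu := half_mem_Ioo hk
    have hcont : ContinuousOn (fun θ => (-1) ^ k * circleIm n θ)
        (Icc (critPt n k) ((k + 1 / 2) * π / n)) := fun θ _ =>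
      ((hasDerivAt_circleIm hn θ).const_mul _).continuousAt.continuousWithinAt
    obtain ⟨θ, hθ, h0⟩ := intermediate_value_Icc' hu.1.le hcont
      ⟨(circleIm_half_neg hn k).le, circleIm_critPt_nonneg hk.le⟩
    refine ⟨θ, ⟨hθ.1, hθ.2.trans_lt hu.2⟩, hθ.2.trans (hu.2.le.trans (critPt_lt_pi hk).le), ?_⟩
    simpa using h0

/-- Parameters in `[0, π]` of the real points of the curve to the right of its center. -/
def rightParams (n : ℕ) : Set ℝ :=
  {θ | θ ∈ Icc 0 π ∧ circleIm n θ = 0 ∧ 0 < circleRe n θ}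

theorem injOn_circleRe {n : ℕ} (hn : 0 < n) : InjOn (circleRe n) (rightParams n) := by
  rintro x ⟨hx, hx0, -⟩ y ⟨hy, hy0, -⟩ h
  have h1 := circleRe_sq_add_circleIm_sq n x
  have h2 := circleRe_sq_add_circleIm_sq n y
  rw [hx0, h] at h1
  rw [hy0] at h2
  have hn' : (0 : ℝ) < 2 * (1 / (n + 1)) * (1 / n) := by positivity
  exact injOn_cos hx hy (mul_left_cancel₀ hn'.ne' (by linarith))

/-- The index of the interval between consecutive critical points that contains `θ`. -/
noncomputable def critIndex (n : ℕ) (θ : ℝ) : ℕ := ⌊θ * (2 * n + 1) / (2 * π)⌋₊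

theorem critIndex_eq_iff {n k : ℕ} {θ : ℝ} (hθ : 0 ≤ θ) :
    critIndex n θ = k ↔ θ ∈ Ico (critPt n k) (critPt n (k + 1)) := by
  have := pi_pos
  rw [critIndex, Nat.floor_eq_iff (by positivity), le_div_iff₀ (by positivity),
    div_lt_iff₀ (by positivity), mem_Ico, critPt, critPt, div_le_iff₀ (by positivity),
    lt_div_iff₀ (by positivity)]
  push_cast
  rw [mul_comm (k : ℝ), mul_comm ((k : ℝ) + 1)]

theorem critIndex_le {n : ℕ} {θ : ℝ} (hθ : θ ∈ Icc 0 π) : critIndex n θ ≤ n := by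
  have := pi_pos
  rw [← Nat.lt_succ_iff, critIndex, Nat.floor_lt (by have := hθ.1; positivity),
    div_lt_iff₀ (by positivity)]
  push_cast
  nlinarith [hθ.2]

theorem bijOn_critIndex {n : ℕ} (hn : 0 < n) :
    BijOn (critIndex n) (rightParams n) {k | Odd k ∧ k ≤ n} := by
  refine ⟨?_, ?_, ?_⟩
  · rintro θ ⟨hθ, h0, hpos⟩
    refine ⟨?_, critIndex_le hθ⟩
    by_contra hev
    rw [Nat.not_odd_iff_even] at hev
    have h := cos_pos_of_circleIm_eq_zero hn (critIndex_le hθ)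
      (Ico_subset_Icc_self ((critIndex_eq_iff hθ.1).1 rfl)) hθ.2 h0
    have := circleRe_neg_of_cos_pos hn (by rw [hev.neg_one_pow]; norm_num) h0 h
    rw [hev.neg_one_pow] at this
    linarith
  · rintro x ⟨hx, hx0, -⟩ y ⟨hy, hy0, -⟩ h
    have hx' := (critIndex_eq_iff hx.1).1 h
    have hy' := (critIndex_eq_iff (n := n) hy.1).1 rfl
    exact (strictAntiOn_circleIm hn (critIndex_le hy)).injOn (Ico_subset_Icc_self hx')
      (Ico_subset_Icc_self hy') (by simp only [hx0, hy0])
  · rintro k ⟨hodd, hk⟩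
    obtain ⟨θ, hθ, hπ, h0⟩ := exists_circleIm_eq_zero hn hk
    have hθ0 := (critPt_nonneg n k).trans hθ.1
    refine ⟨θ, ⟨⟨hθ0, hπ⟩, h0, ?_⟩, (critIndex_eq_iff hθ0).2 hθ⟩
    have := circleRe_neg_of_cos_pos hn (by rw [hodd.neg_one_pow]; norm_num) h0
      (cos_pos_of_circleIm_eq_zero hn hk (Ico_subset_Icc_self hθ) hπ h0)
    rw [hodd.neg_one_pow] at this
    linarith

theorem ncard_odd_le (n : ℕ) : {k : ℕ | Odd k ∧ k ≤ n}.ncard = (n + 1) / 2 := by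
  have : {k : ℕ | Odd k ∧ k ≤ n} =
      (fun j => 2 * j + 1) '' (Finset.range ((n + 1) / 2) : Set ℕ) := by
    ext k
    simp only [mem_ofPred_eq, mem_image, Finset.coe_range, mem_Iio]
    constructor
    · rintro ⟨⟨j, rfl⟩, hk⟩
      exact ⟨j, by omega, rfl⟩
    · rintro ⟨j, hj, rfl⟩
      exact ⟨⟨j, rfl⟩, by omega⟩
  rw [this, ncard_image_of_injective _ (fun a b h => by simpa using h), ncard_coe_finset,
    Finset.card_range]

/-- The curve `f_a({|z|=1})` has exactly `⌊(n+1)/2⌋` intersections with the real axis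
strictly to the right of its center `−1`. -/
theorem real_axis_intersections (n : ℕ) (hn : 4 ≤ n) (a : ℝ) (ha : 1 < a) :
    {w : ℂ | w.im = 0 ∧ -1 < w.re ∧
        ∃ θ : ℝ, w = fa n a (Complex.exp (θ * Complex.I))}.ncard = (n + 1) / 2 := by
  have hn0 : 0 < n := by omega
  have hset : {w : ℂ | w.im = 0 ∧ -1 < w.re ∧
      ∃ θ : ℝ, w = fa n a (Complex.exp (θ * Complex.I))} =
      (fun θ => (⟨(a + 1) * circleRe n θ - 1, 0⟩ : ℂ)) '' rightParams n := by
    ext w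
    simp only [mem_ofPred_eq, mem_image, fa_exp]
    constructor
    · rintro ⟨him, hre, t, rfl⟩
      simp only at him hre
      have h0 : circleIm n t = 0 := (mul_eq_zero.1 him).resolve_left (by linarith)
      obtain ⟨θ, hθ, h1, h2⟩ := exists_mem_Icc_circle_eq n t
      rw [h1] at hre ⊢
      rw [him]
      exact ⟨θ, ⟨hθ, h2 h0, pos_of_mul_pos_right (by linarith) (by linarith : 0 ≤ a + 1)⟩, rfl⟩
    · rintro ⟨θ, ⟨-, h0, hpos⟩, rfl⟩
      have : 0 < (a + 1) * circleRe n θ := mul_pos (by linarith) hpos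
      exact ⟨rfl, by linarith, θ, by rw [h0, mul_zero]⟩
  rw [hset, InjOn.ncard_image, ← ncard_odd_le n, ← (bijOn_critIndex hn0).image_eq,
    (bijOn_critIndex hn0).injOn.ncard_image]
  intro x hx y hy h
  have h := congrArg Complex.re h
  exact injOn_circleRe hn0 hx hy (mul_left_cancel₀ (by linarith : a + 1 ≠ 0) (by linarith))
end
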